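/- arXiv:1804.10470 — 4 statements merged into one kernel-verified Lean document; each statement's English description precedes it below -/
import Mathlib

section
/- Let G be a bipartite graph with bipartition classes A and B such that every vertex b ∈ B has degree at least k. If for every vertex b ∈ B the number of vertices at distance exactly 2 from b is at most 2^{k−1}/e − 1, then G admits an edge labeling with two labels distinguishing neighbors by sets, i.e., gndi(G) = 2 (when G has at least one edge). Moreover, if deg b = k for every b ∈ B and k is sufficiently large, the bound on the number of vertices at distance 2 can be improved to 0.17 · √(k/ln k) · 2^k. -/
open Finset in
/-- The outcomes that avoid every event `A j` with `j ∈ S`. -/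
def avoiding {Ω ι : Type*} [Fintype Ω] [DecidableEq Ω] (A : ι → Finset Ω) (S : Finset ι) :
    Finset Ω :=
  univ.filter fun ω => ∀ j ∈ S, ω ∉ A j

open Finset in
theorem card_avoiding_insert {Ω ι : Type*} [Fintype Ω] [DecidableEq Ω] [DecidableEq ι]
    (A : ι → Finset Ω) (S : Finset ι) (i : ι) :
    (#(avoiding A (insert i S)) : ℝ) = #(avoiding A S) - #(A i ∩ avoiding A S) := by
  have h : avoiding A (insert i S) = avoiding A S \ A i := by
    ext ω
    simp only [avoiding, mem_filter, mem_univ, true_and, mem_insert, forall_eq_or_imp, mem_sdiff]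
    tauto
  have h2 := card_sdiff_add_card_inter (avoiding A S) (A i)
  rw [h, inter_comm, ← h2]
  push_cast
  ring

open Finset in
theorem card_inter_avoiding_le {Ω ι : Type*} [Fintype Ω] [DecidableEq Ω]
    [DecidableEq ι] (A : ι → Finset Ω) (Γ : ι → Finset ι) (x : ι → ℝ)
    (hx0 : ∀ i, 0 ≤ x i) (hx1 : ∀ i, x i < 1)
    (hind : ∀ i S, i ∉ S → Disjoint S (Γ i) →
      #(A i ∩ avoiding A S) * Fintype.card Ω = #(A i) * #(avoiding A S))
    (hA : ∀ i, (#(A i) : ℝ) ≤ x i * (∏ j ∈ Γ i, (1 - x j)) * Fintype.card Ω)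
    (S : Finset ι) (i : ι) (hi : i ∉ S) :
    (#(A i ∩ avoiding A S) : ℝ) ≤ x i * #(avoiding A S) := by
  induction hn : #S using Nat.strong_induction_on generalizing S i with
  | _ n ih =>
  subst hn
  rcases isEmpty_or_nonempty Ω with hΩ | hΩ
  · simp [eq_empty_of_isEmpty]
  have hpos : (0 : ℝ) < Fintype.card Ω := by exact_mod_cast Fintype.card_pos
  have hchain : ∀ T ⊆ S ∩ Γ i,
      (∏ j ∈ T, (1 - x j)) * #(avoiding A (S \ Γ i)) ≤ #(avoiding A (T ∪ S \ Γ i)) := by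
    intro T
    induction T using Finset.induction_on with
    | empty => simp
    | insert j T hj ihT =>
      intro hT
      have hjS := mem_inter.1 (hT (mem_insert_self _ _))
      have hTS := (subset_insert _ _).trans hT
      have hj' : j ∉ T ∪ S \ Γ i := by simp [hj, hjS.2]
      have hlt : #(T ∪ S \ Γ i) < #S := by
        apply card_lt_card
        refine ⟨union_subset (hTS.trans inter_subset_left) sdiff_subset, fun h => hj' (h hjS.1)⟩
      have h1 := ih _ hlt _ j hj' rfl
      rw [prod_insert hj, insert_union, card_avoiding_insert]
      have h2 := mul_le_mul_of_nonneg_left (ihT hTS) (sub_nonneg.2 (hx1 j).le)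
      linarith
  have h1 : (#(A i ∩ avoiding A S) : ℝ) ≤ #(A i ∩ avoiding A (S \ Γ i)) := by
    gcongr
    intro ω
    simp only [avoiding, mem_filter, mem_univ, true_and, mem_sdiff]
    exact fun h j hj => h j hj.1
  have h2 : (#(A i ∩ avoiding A (S \ Γ i)) : ℝ) * Fintype.card Ω =
      #(A i) * #(avoiding A (S \ Γ i)) := by
    exact_mod_cast hind i _ (by simp [hi]) sdiff_disjoint
  have h3 : ∏ j ∈ Γ i, (1 - x j) ≤ ∏ j ∈ S ∩ Γ i, (1 - x j) :=
    prod_le_prod_of_subset_of_le_one inter_subset_right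
      (fun j _ => sub_nonneg.2 (hx1 j).le) (fun j _ _ => by linarith [hx0 j])
  have h4 := hchain _ subset_rfl
  have h5 : S ∩ Γ i ∪ S \ Γ i = S := by
    rw [union_comm, sdiff_union_inter]
  rw [h5] at h4
  have h6 : (#(A i ∩ avoiding A (S \ Γ i)) : ℝ) ≤
      x i * (∏ j ∈ Γ i, (1 - x j)) * #(avoiding A (S \ Γ i)) := by
    refine le_of_mul_le_mul_right ?_ hpos
    rw [h2]
    calc (#(A i) : ℝ) * #(avoiding A (S \ Γ i))
        ≤ (x i * (∏ j ∈ Γ i, (1 - x j)) * Fintype.card Ω) * #(avoiding A (S \ Γ i)) := by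
          gcongr
          exact hA i
      _ = _ := by ring
  calc (#(A i ∩ avoiding A S) : ℝ)
      ≤ x i * ((∏ j ∈ Γ i, (1 - x j)) * #(avoiding A (S \ Γ i))) := by linarith
    _ ≤ x i * ((∏ j ∈ S ∩ Γ i, (1 - x j)) * #(avoiding A (S \ Γ i))) := by
        have := hx0 i
        gcongr
    _ ≤ x i * #(avoiding A S) := mul_le_mul_of_nonneg_left h4 (hx0 i)

open Finset in
/-- The (asymmetric) Lovász local lemma for the uniform measure on a finite set. -/
theorem exists_avoiding_of_local {Ω ι : Type*} [Fintype Ω] [DecidableEq Ω] [Nonempty Ω]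
    [Fintype ι] [DecidableEq ι] (A : ι → Finset Ω) (Γ : ι → Finset ι) (x : ι → ℝ)
    (hx0 : ∀ i, 0 ≤ x i) (hx1 : ∀ i, x i < 1)
    (hind : ∀ i S, i ∉ S → Disjoint S (Γ i) →
      #(A i ∩ avoiding A S) * Fintype.card Ω = #(A i) * #(avoiding A S))
    (hA : ∀ i, (#(A i) : ℝ) ≤ x i * (∏ j ∈ Γ i, (1 - x j)) * Fintype.card Ω) :
    ∃ ω, ∀ i, ω ∉ A i := by
  have hpos : ∀ S : Finset ι, (0 : ℝ) < #(avoiding A S) := by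
    intro S
    induction S using Finset.induction_on with
    | empty => simpa [avoiding] using Fintype.card_pos (α := Ω)
    | insert i S hi ih =>
      rw [card_avoiding_insert]
      have := card_inter_avoiding_le A Γ x hx0 hx1 hind hA S i hi
      nlinarith [hx1 i]
  have h := hpos univ
  rw [Nat.cast_pos, card_pos] at h
  obtain ⟨ω, hω⟩ := h
  exact ⟨ω, by simpa [avoiding] using hω⟩

open Finset in
/-- Events of a finite product space determined by disjoint sets of coordinates are
independent. -/
theorem card_inter_mul_card_of_disjoint {V X : Type*} [Fintype V] [DecidableEq V] [Fintype X]
    [DecidableEq X] (A B : Finset (V → X)) (S T : Finset V) (hST : Disjoint S T)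
    (hA : ∀ w w' : V → X, (∀ v ∈ S, w v = w' v) → w ∈ A → w' ∈ A)
    (hB : ∀ w w' : V → X, (∀ v ∈ T, w v = w' v) → w ∈ B → w' ∈ B) :
    #(A ∩ B) * Fintype.card (V → X) = #A * #B := by
  rw [← card_univ, ← card_product, ← card_product]
  have key : ∀ w w' : V → X,
      S.piecewise (S.piecewise w w') (S.piecewise w' w) = w := by
    intro w w'
    ext v
    by_cases h : v ∈ S <;> simp [h]
  have hT : ∀ v ∈ T, v ∉ S := fun v hv hv' => disjoint_left.1 hST hv' hv
  refine card_nbij' (fun p => (S.piecewise p.1 p.2, S.piecewise p.2 p.1))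
    (fun p => (S.piecewise p.1 p.2, S.piecewise p.2 p.1)) ?_ ?_ ?_ ?_
  · rintro ⟨w, w'⟩ h
    simp only [coe_product, coe_inter, coe_univ, Set.mem_prod, Set.mem_inter_iff, mem_coe,
      Set.mem_univ, and_true] at h ⊢
    exact ⟨hA w _ (fun v hv => by simp [hv]) h.1, hB w _ (fun v hv => by simp [hT v hv]) h.2⟩
  · rintro ⟨w, w'⟩ h
    simp only [coe_product, coe_inter, coe_univ, Set.mem_prod, Set.mem_inter_iff, mem_coe,
      Set.mem_univ, and_true] at h ⊢
    exact ⟨hA w _ (fun v hv => by simp [hv]) h.1, hB w' _ (fun v hv => by simp [hT v hv]) h.2⟩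
  · rintro ⟨w, w'⟩ _
    simp [key]
  · rintro ⟨w, w'⟩ _
    simp [key]

open Finset in
/-- The Lovász local lemma for events on a finite product space, each determined by a set of
coordinates. -/
theorem exists_forall_notMem_of_local {V X ι : Type*} [Fintype V] [DecidableEq V] [Fintype X]
    [DecidableEq X] [Nonempty X] [Fintype ι] [DecidableEq ι] (A : ι → Finset (V → X))
    (S : ι → Finset V) (x : ι → ℝ) (hx0 : ∀ i, 0 ≤ x i) (hx1 : ∀ i, x i < 1)
    (hS : ∀ i, ∀ w w' : V → X, (∀ v ∈ S i, w v = w' v) → w ∈ A i → w' ∈ A i)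
    (hA : ∀ i, (#(A i) : ℝ) / Fintype.card (V → X) ≤
      x i * ∏ j with j ≠ i ∧ ¬Disjoint (S i) (S j), (1 - x j)) :
    ∃ w, ∀ i, w ∉ A i := by
  have hpos : (0 : ℝ) < Fintype.card (V → X) := by exact_mod_cast Fintype.card_pos
  refine exists_avoiding_of_local A (fun i => {j | j ≠ i ∧ ¬Disjoint (S i) (S j)}) x hx0 hx1
    ?_ fun i => (div_le_iff₀ hpos).1 (hA i)
  intro i J hi hJ
  refine card_inter_mul_card_of_disjoint _ _ (S i) (J.biUnion S) ?_ (hS i) ?_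
  · rw [disjoint_biUnion_right]
    intro j hj
    by_contra h
    exact disjoint_left.1 hJ hj (by simpa using ⟨fun e => hi (e ▸ hj), h⟩)
  · intro w w' hw
    simp only [avoiding, mem_filter, mem_univ, true_and]
    exact fun h j hj hj' => h j hj
      (hS j w' w (fun v hv => (hw v (mem_biUnion.2 ⟨j, hj, hv⟩)).symm) hj')

open Finset in
/-- The probability that independent uniform coordinates indexed by `S` fall into given sets. -/
theorem card_filter_forall_mem_div {V X : Type*} [Fintype V] [DecidableEq V] [Fintype X]
    [DecidableEq X] [Nonempty X] (S : Finset V) (T : V → Finset X) :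
    (#{w : V → X | ∀ v ∈ S, w v ∈ T v} : ℝ) / Fintype.card (V → X) =
      ∏ v ∈ S, (#(T v) : ℝ) / Fintype.card X := by
  have h : (univ.filter fun w : V → X => ∀ v ∈ S, w v ∈ T v) =
      Fintype.piFinset fun v => if v ∈ S then T v else univ := by
    ext w
    simp only [mem_filter, mem_univ, true_and, Fintype.mem_piFinset]
    refine forall_congr' fun v => ?_
    by_cases hv : v ∈ S <;> simp [hv]
  have hX : (Fintype.card X : ℝ) ≠ 0 := by exact_mod_cast Fintype.card_ne_zero
  rw [h, Fintype.card_piFinset, Fintype.card_pi, Nat.cast_prod, Nat.cast_prod, ← prod_div_distrib,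
    ← prod_subset (subset_univ S)]
  · exact prod_congr rfl fun v hv => by simp [hv]
  · intro v _ hv
    simp [hv, hX]

open Finset in
theorem card_filter_forall_mem_const_div {V X : Type*} [Fintype V] [DecidableEq V] [Fintype X]
    [DecidableEq X] [Nonempty X] (S : Finset V) (T : Finset X) :
    (#{w : V → X | ∀ v ∈ S, w v ∈ T} : ℝ) / Fintype.card (V → X) =
      ((#T : ℝ) / Fintype.card X) ^ #S := by
  rw [card_filter_forall_mem_div S fun _ => T, prod_const]

open Finset in
/-- A `k`-uniform hypergraph in which each edge meets at most `2 ^ (k - 1) / e - 1` others has a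
proper two-coloring. -/
theorem exists_two_coloring_of_exp {V β : Type*} [Fintype V] [DecidableEq V] [Fintype β]
    [DecidableEq β] (N : β → Finset V) (k : ℕ) (hN : ∀ b, #(N b) = k)
    (hdeg : ∀ b, (#{b' | b' ≠ b ∧ ¬Disjoint (N b) (N b')} : ℝ) ≤ 2 ^ (k - 1) / Real.exp 1 - 1) :
    ∃ f : V → Fin 2, ∀ b, ∀ i : Fin 2, ∃ v ∈ N b, f v = i := by
  rcases isEmpty_or_nonempty β with hβ | ⟨⟨b₀⟩⟩
  · exact ⟨fun _ => 0, fun b => isEmptyElim b⟩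
  set E : ℝ := 2 ^ (k - 1) / Real.exp 1 with hE
  have hE1 : 1 ≤ E := by
    have h1 := hdeg b₀
    have h2 : (0 : ℝ) ≤ #{b' | b' ≠ b₀ ∧ ¬Disjoint (N b₀) (N b')} := Nat.cast_nonneg _
    linarith
  have hE0 : 0 < E := by linarith
  have hk : k ≠ 0 := by
    rintro rfl
    have h1 : (1 : ℝ) < Real.exp 1 := Real.one_lt_exp_iff.2 one_pos
    rw [hE, le_div_iff₀ (by positivity)] at hE1
    norm_num at hE1
  let A : β → Finset (V → Fin 2) := fun b => univ.filter fun w => ∃ i, ∀ v ∈ N b, w v = i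
  obtain ⟨w, hw⟩ := exists_forall_notMem_of_local A N (fun _ => 1 - Real.exp (-1 / E))
    (fun _ => by
      rw [sub_nonneg, Real.exp_le_one_iff]
      exact div_nonpos_of_nonpos_of_nonneg (by norm_num) hE0.le)
    (fun _ => by linarith [Real.exp_pos (-1 / E)])
    (fun b w w' h => by
      simp only [A, mem_filter, mem_univ, true_and]
      rintro ⟨i, hi⟩
      exact ⟨i, fun v hv => by rw [← h v hv, hi v hv]⟩)
    (fun b => by
      have hcard : (#(A b) : ℝ) / Fintype.card (V → Fin 2) ≤ 1 / 2 ^ (k - 1) := by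
        have h1 : A b ⊆ univ.biUnion fun i : Fin 2 =>
            (univ.filter fun w : V → Fin 2 => ∀ v ∈ N b, w v ∈ ({i} : Finset (Fin 2))) := by
          intro w
          simp [A]
        have h2 : (#(A b) : ℝ) ≤ ∑ i : Fin 2,
            (#{w : V → Fin 2 | ∀ v ∈ N b, w v ∈ ({i} : Finset (Fin 2))} : ℝ) := by
          exact_mod_cast (card_le_card h1).trans card_biUnion_le
        calc (#(A b) : ℝ) / Fintype.card (V → Fin 2)
            ≤ (∑ i : Fin 2, (#{w : V → Fin 2 | ∀ v ∈ N b, w v ∈ ({i} : Finset (Fin 2))} : ℝ)) /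
              Fintype.card (V → Fin 2) := by gcongr
          _ = ∑ i : Fin 2, (1 / 2 : ℝ) ^ k := by
              rw [sum_div]
              refine sum_congr rfl fun i _ => ?_
              rw [card_filter_forall_mem_const_div, hN]
              simp
          _ = 1 / 2 ^ (k - 1) := by
              obtain ⟨k, rfl⟩ := Nat.exists_eq_succ_of_ne_zero hk
              simp only [sum_const, card_univ, Fintype.card_fin, nsmul_eq_mul, Nat.succ_eq_add_one,
                pow_succ, add_tsub_cancel_right]
              rw [one_div_pow]
              push_cast
              field_simp
      refine hcard.trans ?_
      rw [prod_const, sub_sub_cancel, ← Real.exp_nat_mul]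
      have h3 : Real.exp (-1 + 1 / E) ≤ Real.exp
          (#{b' | b' ≠ b ∧ ¬Disjoint (N b) (N b')} * (-1 / E)) := by
        rw [Real.exp_le_exp]
        have h4 := div_le_div_of_nonneg_right (hdeg b) hE0.le
        rw [sub_div, div_self hE0.ne'] at h4
        have h5 : (#{b' | b' ≠ b ∧ ¬Disjoint (N b) (N b')} : ℝ) * (-1 / E) =
          -(#{b' | b' ≠ b ∧ ¬Disjoint (N b) (N b')} / E) := by ring
        linarith
      have h6 : 0 ≤ 1 - Real.exp (-1 / E) := by
        rw [sub_nonneg, Real.exp_le_one_iff]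
        exact div_nonpos_of_nonpos_of_nonneg (by norm_num) hE0.le
      refine le_trans ?_ (mul_le_mul_of_nonneg_left h3 h6)
      have h7 : (1 - Real.exp (-1 / E)) * Real.exp (-1 + 1 / E) =
          Real.exp (-1) * (Real.exp (1 / E) - 1) := by
        rw [sub_mul, ← Real.exp_add, mul_sub, ← Real.exp_add]
        ring_nf
      have h8 := Real.add_one_le_exp (1 / E)
      have h9 : 1 / 2 ^ (k - 1) = Real.exp (-1) * (1 / E) := by
        rw [hE, Real.exp_neg]
        field_simp
      rw [h7, h9]
      have := Real.exp_pos (-1)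
      gcongr
      linarith)
  refine ⟨w, fun b i => ?_⟩
  by_contra! h
  apply hw b
  simp only [A, mem_filter, mem_univ, true_and]
  refine ⟨1 - i, fun v hv => ?_⟩
  have := h v hv
  omega

/-- Greedy coloring along an injective key: if no vertex is both the last vertex of some edge and
the first vertex of some edge, then the hypergraph is two-colorable. -/
theorem exists_two_coloring_of_key {V β : Type*} [Finite V] (N : β → Finset V) (g : V → ℕ)
    (hg : Function.Injective g) (hne : ∀ b, (N b).Nonempty)
    (h : ∀ b b' v, v ∈ N b → v ∈ N b' → (∀ u ∈ N b, g u ≤ g v) → ¬∀ u ∈ N b', g v ≤ g u) :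
    ∃ f : V → Fin 2, ∀ b, ∀ i : Fin 2, ∃ v ∈ N b, f v = i := by
  classical
  obtain ⟨red, hred⟩ : ∃ red : V → Prop, ∀ v, red v ↔
      ∃ b, v ∈ N b ∧ ∀ u ∈ N b, u ≠ v → g u < g v ∧ ¬red u := by
    have hwf : WellFounded fun u v : V => g u < g v := (measure g).wf
    let F : ∀ v : V, (∀ u : V, g u < g v → Prop) → Prop := fun v r =>
      ∃ b, v ∈ N b ∧ ∀ u ∈ N b, u ≠ v → ∃ hu : g u < g v, ¬r u hu
    refine ⟨hwf.fix F, fun v => ?_⟩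
    rw [hwf.fix_eq]
    simp only [F, exists_prop]
  refine ⟨fun v => if red v then 1 else 0, fun b i => ?_⟩
  by_contra! hc
  fin_cases i
  · have hall : ∀ v ∈ N b, red v := fun v hv => by
      by_contra hv'
      exact hc v hv (by simp [hv'])
    obtain ⟨v, hv, hmin⟩ := (N b).exists_min_image g (hne b)
    obtain ⟨b', hvb', hb'⟩ := (hred v).1 (hall v hv)
    refine h b' b v hvb' hv (fun u hu => ?_) hmin
    by_cases huv : u = v
    · rw [huv]
    · exact (hb' u hu huv).1.le
  · have hall : ∀ v ∈ N b, ¬red v := fun v hv hv' => hc v hv (by simp [hv'])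
    obtain ⟨v, hv, hmax⟩ := (N b).exists_max_image g (hne b)
    exact hall v hv ((hred v).2 ⟨b, hv, fun u hu huv =>
      ⟨lt_of_le_of_ne (hmax u hu) fun e => huv (hg e), hall u hu⟩⟩)

open Finset in
/-- Greedy coloring along weights, with ties broken arbitrarily. -/
theorem exists_two_coloring_of_weight {V β : Type*} [Fintype V] [DecidableEq V]
    (N : β → Finset V) (w : V → ℕ) (hN : ∀ b, 2 ≤ #(N b))
    (h : ∀ b b' v, N b ∩ N b' = {v} → (∀ u ∈ N b, w u ≤ w v) → ¬∀ u ∈ N b', w v ≤ w u) :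
    ∃ f : V → Fin 2, ∀ b, ∀ i : Fin 2, ∃ v ∈ N b, f v = i := by
  let idx := Fintype.equivFin V
  let g : V → ℕ := fun v => idx v + Fintype.card V * w v
  have hdiv : ∀ v, g v / Fintype.card V = w v := fun v => by
    have hlt := (idx v).isLt
    rw [Nat.add_mul_div_left _ _ (by omega), Nat.div_eq_of_lt hlt, zero_add]
  have hmono : ∀ u v, g u ≤ g v → w u ≤ w v := fun u v huv => by
    rw [← hdiv u, ← hdiv v]
    exact Nat.div_le_div_right huv
  have hg : Function.Injective g := fun u v huv => by
    have hw : w u = w v := by rw [← hdiv u, ← hdiv v, huv]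
    have : (idx u : ℕ) = idx v := by
      simp only [g, hw] at huv
      omega
    exact idx.injective (Fin.ext this)
  refine exists_two_coloring_of_key N g hg (fun b => card_pos.1 (by have := hN b; omega)) ?_
  intro b b' v hv hv' hmax hmin
  refine h b b' v ?_ (fun u hu => hmono _ _ (hmax u hu)) (fun u hu => hmono _ _ (hmin u hu))
  ext u
  rw [mem_inter, mem_singleton]
  refine ⟨fun hu => hg (le_antisymm (hmax u hu.1) (hmin u hu.2)), ?_⟩
  rintro rfl
  exact ⟨hv, hv'⟩

/-- The Weierstrass product inequality. -/
theorem one_sub_sum_le_prod_one_sub {ι : Type*} (s : Finset ι) (x : ι → ℝ)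
    (hx0 : ∀ i, 0 ≤ x i) (hx1 : ∀ i, x i ≤ 1) :
    1 - ∑ i ∈ s, x i ≤ ∏ i ∈ s, (1 - x i) := by
  classical
  induction s using Finset.induction_on with
  | empty => simp
  | insert i s hi ih =>
    rw [Finset.sum_insert hi, Finset.prod_insert hi]
    have h1 := mul_le_mul_of_nonneg_left ih (sub_nonneg.2 (hx1 i))
    have h2 := mul_nonneg (hx0 i) (Finset.sum_nonneg fun j (_ : j ∈ s) => hx0 j)
    nlinarith

open Finset in
/-- A form of the local lemma in which each event has few neighbours in total probability. -/
theorem exists_forall_notMem_of_sum_le {V X ι : Type*} [Fintype V] [DecidableEq V] [Fintype X]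
    [DecidableEq X] [Nonempty X] [Fintype ι] [DecidableEq ι] (A : ι → Finset (V → X))
    (S : ι → Finset V) (p : ι → ℝ) (hp0 : ∀ i, 0 ≤ p i) (hp1 : ∀ i, p i < 1 / 2)
    (hS : ∀ i, ∀ w w' : V → X, (∀ v ∈ S i, w v = w' v) → w ∈ A i → w' ∈ A i)
    (hA : ∀ i, (#(A i) : ℝ) / Fintype.card (V → X) ≤ p i)
    (hsum : ∀ i, ∑ j with ¬Disjoint (S i) (S j), p j ≤ 1 / 4) :
    ∃ w, ∀ i, w ∉ A i := by
  refine exists_forall_notMem_of_local A S (fun i => 2 * p i) (fun i => by linarith [hp0 i])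
    (fun i => by linarith [hp1 i]) hS fun i => (hA i).trans ?_
  have h1 := one_sub_sum_le_prod_one_sub (univ.filter fun j => j ≠ i ∧ ¬Disjoint (S i) (S j))
    (fun i => 2 * p i) (fun i => by linarith [hp0 i]) (fun i => by linarith [hp1 i])
  rw [← mul_sum] at h1
  have h2 : ∑ j with j ≠ i ∧ ¬Disjoint (S i) (S j), p j ≤ ∑ j with ¬Disjoint (S i) (S j), p j :=
    sum_le_sum_of_subset_of_nonneg (monotone_filter_right _ fun j _ hj => hj.2)
      fun j _ _ => hp0 j
  have h3 : (1 : ℝ) / 2 ≤ ∏ j with j ≠ i ∧ ¬Disjoint (S i) (S j), (1 - 2 * p j) := by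
    linarith [hsum i]
  have h4 := mul_le_mul_of_nonneg_left h3 (hp0 i)
  linarith

open Finset in
theorem card_filter_forall_le_forall_ge_div {V : Type*} [Fintype V] [DecidableEq V] (k m : ℕ)
    (hm : 0 < m) (P Q : Finset V) (v : V) (hPQ : P ∩ Q = {v}) (hP : #P = k) (hQ : #Q = k)
    (t : Fin (2 * m)) :
    (#{w : V → Fin (2 * m) | w v = t ∧ (∀ u ∈ P, w u ≤ w v) ∧ ∀ u ∈ Q, w v ≤ w u} : ℝ) /
      Fintype.card (V → Fin (2 * m)) ≤
        1 / (2 * m) * ((2 * m + 1) / (4 * m)) ^ (2 * (k - 1)) := by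
  have : Nonempty (Fin (2 * m)) := ⟨t⟩
  have hv : v ∈ P ∧ v ∈ Q := mem_inter.1 (hPQ ▸ mem_singleton_self v)
  have huniq : ∀ u ∈ P, u ∈ Q → u = v := fun u h1 h2 =>
    mem_singleton.1 (hPQ ▸ mem_inter.2 ⟨h1, h2⟩)
  let T : V → Finset (Fin (2 * m)) := fun u =>
    if u = v then {t} else if u ∈ P then Iic t else Ici t
  have hset : (univ.filter fun w : V → Fin (2 * m) =>
      w v = t ∧ (∀ u ∈ P, w u ≤ w v) ∧ ∀ u ∈ Q, w v ≤ w u) ⊆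
      univ.filter fun w => ∀ u ∈ insert v (P.erase v ∪ Q.erase v), w u ∈ T u := by
    intro w
    simp only [mem_filter, mem_univ, true_and]
    rintro ⟨rfl, h1, h2⟩ u hu
    by_cases huv : u = v
    · simp [T, huv]
    · by_cases huP : u ∈ P
      · simpa [T, huv, huP] using h1 u huP
      · have huQ : u ∈ Q := by simpa [huv, huP] using hu
        simpa [T, huv, huP] using h2 u huQ
  have hdisj : Disjoint (P.erase v) (Q.erase v) := by
    rw [disjoint_left]
    intro u h1 h2
    rw [mem_erase] at h1 h2
    exact h1.1 (huniq u h1.2 h2.2)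
  have hm' : (0 : ℝ) < m := by exact_mod_cast hm
  calc (#{w : V → Fin (2 * m) | w v = t ∧ (∀ u ∈ P, w u ≤ w v) ∧ ∀ u ∈ Q, w v ≤ w u} : ℝ) /
        Fintype.card (V → Fin (2 * m))
      ≤ (#{w : V → Fin (2 * m) | ∀ u ∈ insert v (P.erase v ∪ Q.erase v), w u ∈ T u} : ℝ) /
        Fintype.card (V → Fin (2 * m)) := by gcongr
    _ = 1 / (2 * m) * (((t + 1) / (2 * m)) ^ (k - 1) * ((2 * m - t) / (2 * m)) ^ (k - 1)) := by
        rw [card_filter_forall_mem_div, prod_insert (by simp), prod_union hdisj]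
        have h1 : ∀ u ∈ P.erase v, (#(T u) : ℝ) / Fintype.card (Fin (2 * m)) =
            (t + 1) / (2 * m) := by
          intro u hu
          rw [mem_erase] at hu
          simp [T, hu.1, hu.2]
        have h2 : ∀ u ∈ Q.erase v, (#(T u) : ℝ) / Fintype.card (Fin (2 * m)) =
            (2 * m - t) / (2 * m) := by
          intro u hu
          rw [mem_erase] at hu
          have : u ∉ P := fun h => hu.1 (huniq u h hu.2)
          simp [T, hu.1, this, Nat.cast_sub t.isLt.le]
        rw [prod_congr rfl h1, prod_congr rfl h2, prod_const, prod_const, card_erase_of_mem hv.1,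
          card_erase_of_mem hv.2, hP, hQ]
        simp [T]
    _ ≤ 1 / (2 * m) * ((2 * m + 1) / (4 * m)) ^ (2 * (k - 1)) := by
        have ht : (t : ℝ) ≤ 2 * m := by exact_mod_cast t.isLt.le
        rw [← mul_pow, pow_mul]
        have h0 : (0 : ℝ) ≤ (t + 1) / (2 * m) * ((2 * m - t) / (2 * m)) :=
          mul_nonneg (by positivity) (div_nonneg (by linarith) (by positivity))
        gcongr
        rw [div_mul_div_comm, div_pow, div_le_div_iff₀ (by positivity) (by positivity)]
        have h1 : ((t : ℝ) + 1) * (2 * m - t) * 4 ≤ (2 * m + 1) ^ 2 := by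
          nlinarith [sq_nonneg ((t : ℝ) + 1 - (2 * m - t))]
        nlinarith [mul_le_mul_of_nonneg_right h1 (sq_nonneg (m : ℝ))]

open Finset in
theorem card_filter_conflict_div_le {V : Type*} [Fintype V] [DecidableEq V] (k m s : ℕ)
    (hm : 0 < m) (P Q : Finset V) (hPQ : #(P ∩ Q) = 1) (hP : #P = k) (hQ : #Q = k) :
    (#{w : V → Fin (2 * m) | ∃ v ∈ P ∩ Q, m - s ≤ (w v).val ∧ (w v).val < m + s ∧
      (∀ u ∈ P, w u ≤ w v) ∧ ∀ u ∈ Q, w v ≤ w u} : ℝ) / Fintype.card (V → Fin (2 * m)) ≤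
        s / m * ((2 * m + 1) / (4 * m)) ^ (2 * (k - 1)) := by
  obtain ⟨v, hv⟩ := card_eq_one.1 hPQ
  have : Nonempty (Fin (2 * m)) := ⟨⟨0, by omega⟩⟩
  have hm' : (0 : ℝ) < m := by exact_mod_cast hm
  let I : Finset (Fin (2 * m)) := univ.filter fun t => m - s ≤ t.val ∧ t.val < m + s
  have hI : #I ≤ 2 * s := by
    have h1 : #I ≤ #(Ico (m - s) (m + s)) :=
      card_le_card_of_injOn Fin.val (fun t ht => by simpa [I] using ht) Fin.val_injective.injOn
    rw [Nat.card_Ico] at h1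
    omega
  have hset : (univ.filter fun w : V → Fin (2 * m) => ∃ v ∈ P ∩ Q, m - s ≤ (w v).val ∧
      (w v).val < m + s ∧ (∀ u ∈ P, w u ≤ w v) ∧ ∀ u ∈ Q, w v ≤ w u) ⊆
      I.biUnion fun t => univ.filter fun w : V → Fin (2 * m) =>
        w v = t ∧ (∀ u ∈ P, w u ≤ w v) ∧ ∀ u ∈ Q, w v ≤ w u := by
    intro w
    simp only [hv, mem_singleton, exists_eq_left, mem_filter, mem_univ, true_and, mem_biUnion, I]
    rintro ⟨h1, h2, h3⟩
    exact ⟨w v, ⟨h1, h2⟩, rfl, h3⟩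
  have hle := (card_le_card hset).trans card_biUnion_le
  calc _ ≤ (∑ t ∈ I, (#{w : V → Fin (2 * m) |
          w v = t ∧ (∀ u ∈ P, w u ≤ w v) ∧ ∀ u ∈ Q, w v ≤ w u} : ℝ)) /
            Fintype.card (V → Fin (2 * m)) := by
        gcongr
        exact_mod_cast hle
    _ ≤ ∑ t ∈ I, 1 / (2 * m) * ((2 * m + 1) / (4 * m) : ℝ) ^ (2 * (k - 1)) := by
        rw [sum_div]
        exact sum_le_sum fun t _ => card_filter_forall_le_forall_ge_div k m hm P Q v hv hP hQ t
    _ ≤ (2 * s : ℕ) * (1 / (2 * m) * ((2 * m + 1) / (4 * m) : ℝ) ^ (2 * (k - 1))) := by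
        rw [sum_const, nsmul_eq_mul]
        gcongr
    _ = s / m * ((2 * m + 1) / (4 * m)) ^ (2 * (k - 1)) := by
        push_cast
        field_simp

open Finset in
theorem card_filter_extreme_div_le {V : Type*} [Fintype V] [DecidableEq V] (k m s : ℕ)
    (hm : 0 < m) (hs : s ≤ m) (P : Finset V) (hP : #P = k) :
    (#{w : V → Fin (2 * m) | (∀ v ∈ P, (w v).val < m - s) ∨ ∀ v ∈ P, m + s ≤ (w v).val} : ℝ) /
      Fintype.card (V → Fin (2 * m)) ≤ 2 * ((m - s) / (2 * m)) ^ k := by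
  have : Nonempty (Fin (2 * m)) := ⟨⟨0, by omega⟩⟩
  let L : Finset (Fin (2 * m)) := univ.filter fun t => t.val < m - s
  let R : Finset (Fin (2 * m)) := univ.filter fun t => m + s ≤ t.val
  have hL : #L ≤ m - s := by
    have h1 : #L ≤ #(range (m - s)) :=
      card_le_card_of_injOn Fin.val (fun t ht => by simpa [L] using ht) Fin.val_injective.injOn
    rwa [card_range] at h1
  have hR : #R ≤ m - s := by
    have h1 : #R ≤ #(Ico (m + s) (2 * m)) :=
      card_le_card_of_injOn Fin.val (fun t ht => by simpa [R] using ht) Fin.val_injective.injOn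
    rw [Nat.card_Ico] at h1
    omega
  have hbox : ∀ T : Finset (Fin (2 * m)), #T ≤ m - s →
      (#{w : V → Fin (2 * m) | ∀ v ∈ P, w v ∈ T} : ℝ) / Fintype.card (V → Fin (2 * m)) ≤
        ((m - s) / (2 * m)) ^ k := by
    intro T hT
    rw [card_filter_forall_mem_const_div, hP, Fintype.card_fin]
    push_cast
    gcongr
    rw [← Nat.cast_sub hs]
    exact_mod_cast hT
  have h1 := hbox L hL
  have h2 := hbox R hR
  rw [filter_or]
  have h3 := card_union_le
    (univ.filter fun w : V → Fin (2 * m) => ∀ v ∈ P, (w v).val < m - s)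
    (univ.filter fun w : V → Fin (2 * m) => ∀ v ∈ P, m + s ≤ (w v).val)
  simp only [L, R, mem_filter, mem_univ, true_and] at h1 h2
  refine le_trans ?_ ((add_le_add h1 h2).trans_eq (two_mul _).symm)
  rw [← add_div]
  gcongr
  exact_mod_cast h3

open Finset in
/-- The total weight of the events (edges and ordered pairs of intersecting edges) that meet a
given edge. -/
theorem sum_meeting_le {V β : Type*} [DecidableEq V] [Fintype β] [DecidableEq β]
    (N : β → Finset V) (D a c : ℝ) (ha : 0 ≤ a) (hc : 0 ≤ c)
    (hcard : ∀ b, 2 ≤ #(N b))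
    (hdeg : ∀ b, (#{b' | b' ≠ b ∧ ¬Disjoint (N b) (N b')} : ℝ) ≤ D) (b : β) :
    (∑ j : β, if ¬Disjoint (N b) (N j) then a else 0) +
      (∑ j : β, ∑ l : β, if ¬Disjoint (N b) (N j ∪ N l) then
        (if #(N j ∩ N l) = 1 then c else 0) else 0) ≤
      (D + 1) * a + 2 * ((D + 1) * D * c) := by
  have hD : 0 ≤ D := le_trans (Nat.cast_nonneg _) (hdeg b)
  let I : β → ℝ := fun j => if ¬Disjoint (N b) (N j) then 1 else 0
  let J : β → β → ℝ := fun j l => if l ≠ j ∧ ¬Disjoint (N j) (N l) then 1 else 0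
  have hI0 : ∀ j, 0 ≤ I j := fun j => by dsimp only [I]; split_ifs <;> norm_num
  have hJ0 : ∀ j l, 0 ≤ J j l := fun j l => by dsimp only [J]; split_ifs <;> norm_num
  have hJs : ∀ j l, J j l = J l j := fun j l => by
    simp only [J, disjoint_comm (a := N j), ne_comm (a := l)]
  have hI : ∑ j, I j ≤ D + 1 := by
    have h1 : (univ.filter fun j => ¬Disjoint (N b) (N j)) ⊆
        insert b (univ.filter fun j => j ≠ b ∧ ¬Disjoint (N b) (N j)) := by
      intro j hj
      by_cases hjb : j = b <;> simp_all
    have h2 := (card_le_card h1).trans (card_insert_le _ _)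
    simp only [I, sum_boole]
    have h3 : (#{j | ¬Disjoint (N b) (N j)} : ℝ) ≤
        #{j | j ≠ b ∧ ¬Disjoint (N b) (N j)} + 1 := by exact_mod_cast h2
    linarith [hdeg b]
  have hJ : ∀ j, ∑ l, J j l ≤ D := fun j => by
    simp only [J, sum_boole]
    exact hdeg j
  have hIJ : ∑ j, ∑ l, I j * J j l ≤ (D + 1) * D := by
    calc ∑ j, ∑ l, I j * J j l = ∑ j, I j * ∑ l, J j l := by simp_rw [mul_sum]
      _ ≤ ∑ j, I j * D := sum_le_sum fun j _ => mul_le_mul_of_nonneg_left (hJ j) (hI0 j)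
      _ ≤ (D + 1) * D := by
        rw [← sum_mul]
        exact mul_le_mul_of_nonneg_right hI hD
  have hIJ' : ∑ j, ∑ l, I l * J j l ≤ (D + 1) * D := by
    rw [sum_comm]
    simp_rw [fun j l => hJs l j]
    exact hIJ
  have h1 : (∑ j : β, if ¬Disjoint (N b) (N j) then a else 0) ≤ (D + 1) * a := by
    calc (∑ j : β, if ¬Disjoint (N b) (N j) then a else 0) = (∑ j, I j) * a := by
          rw [sum_mul]
          refine sum_congr rfl fun j _ => ?_
          simp only [I, ite_mul, one_mul, zero_mul]
      _ ≤ _ := by gcongr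
  have h2 : ∀ j l, (if ¬Disjoint (N b) (N j ∪ N l) then
      (if #(N j ∩ N l) = 1 then c else 0) else 0) ≤ (I j * J j l + I l * J j l) * c := by
    intro j l
    have hnn : 0 ≤ (I j * J j l + I l * J j l) * c :=
      mul_nonneg (add_nonneg (mul_nonneg (hI0 j) (hJ0 j l)) (mul_nonneg (hI0 l) (hJ0 j l))) hc
    by_cases h3 : Disjoint (N b) (N j ∪ N l)
    · rwa [if_neg (not_not.2 h3)]
    rw [if_pos h3]
    split_ifs with h4
    · have hJ1 : J j l = 1 := by
        refine if_pos ⟨?_, ?_⟩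
        · rintro rfl
          rw [inter_self] at h4
          have := hcard l
          omega
        · rw [disjoint_iff_inter_eq_empty, ← card_eq_zero]
          omega
      rw [hJ1, mul_one, mul_one]
      refine le_mul_of_one_le_left hc ?_
      rw [disjoint_union_right, not_and_or] at h3
      rcases h3 with h3 | h3
      · have : I j = 1 := if_pos h3
        linarith [hI0 l]
      · have : I l = 1 := if_pos h3
        linarith [hI0 j]
    · exact hnn
  have h3 : (∑ j : β, ∑ l : β, if ¬Disjoint (N b) (N j ∪ N l) then
      (if #(N j ∩ N l) = 1 then c else 0) else 0) ≤ 2 * ((D + 1) * D * c) := by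
    calc _ ≤ ∑ j, ∑ l, (I j * J j l + I l * J j l) * c :=
          sum_le_sum fun j _ => sum_le_sum fun l _ => h2 j l
      _ = ((∑ j, ∑ l, I j * J j l) + ∑ j, ∑ l, I l * J j l) * c := by
          simp_rw [← sum_mul, sum_add_distrib]
      _ ≤ ((D + 1) * D + (D + 1) * D) * c := by gcongr
      _ = _ := by ring
  linarith

open Finset in
/-- A `k`-uniform hypergraph with bounded edge degree has a proper two-coloring, found by greedy
coloring along random weights; the weights range over `2 * m` values, of which the middle
`2 * s` ones play a special role. -/
theorem exists_two_coloring_of_greedy {V β : Type*} [Fintype V] [DecidableEq V] [Fintype β]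
    [DecidableEq β] (N : β → Finset V) (k m s : ℕ) (D : ℝ) (hk : 2 ≤ k) (hm : 0 < m)
    (hs : s ≤ m) (hN : ∀ b, #(N b) = k)
    (hdeg : ∀ b, (#{b' | b' ≠ b ∧ ¬Disjoint (N b) (N b')} : ℝ) ≤ D)
    (hbound : (D + 1) * (2 * ((m - s) / (2 * m)) ^ k) +
      2 * ((D + 1) * D * (s / m * ((2 * m + 1) / (4 * m)) ^ (2 * (k - 1)))) ≤ 1 / 8) :
    ∃ f : V → Fin 2, ∀ b, ∀ i : Fin 2, ∃ v ∈ N b, f v = i := by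
  have : Nonempty (Fin (2 * m)) := ⟨⟨0, by omega⟩⟩
  have hm' : (0 : ℝ) < m := by exact_mod_cast hm
  have hs' : (s : ℝ) ≤ m := by exact_mod_cast hs
  set a : ℝ := 2 * ((m - s) / (2 * m)) ^ k with ha_def
  set c : ℝ := s / m * ((2 * m + 1) / (4 * m)) ^ (2 * (k - 1)) with hc_def
  have ha : 0 ≤ a := mul_nonneg zero_le_two
    (pow_nonneg (div_nonneg (by linarith) (by positivity)) _)
  have hc : 0 ≤ c := by positivity
  let A : β ⊕ β × β → Finset (V → Fin (2 * m)) := Sum.elim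
    (fun b => univ.filter fun w => (∀ v ∈ N b, (w v).val < m - s) ∨ ∀ v ∈ N b, m + s ≤ (w v).val)
    (fun q => if #(N q.1 ∩ N q.2) = 1 then
      univ.filter fun w => ∃ v ∈ N q.1 ∩ N q.2, m - s ≤ (w v).val ∧ (w v).val < m + s ∧
        (∀ u ∈ N q.1, w u ≤ w v) ∧ ∀ u ∈ N q.2, w v ≤ w u
      else ∅)
  let S : β ⊕ β × β → Finset V := Sum.elim N fun q => N q.1 ∪ N q.2
  let p : β ⊕ β × β → ℝ := Sum.elim (fun _ => a)
    fun q => if #(N q.1 ∩ N q.2) = 1 then c else 0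
  have hp0 : ∀ i, 0 ≤ p i := by
    rintro (b | q)
    · exact ha
    · dsimp only [p, Sum.elim_inr]
      split_ifs
      exacts [hc, le_rfl]
  have hedge : ∀ b, ∑ j with ¬Disjoint (N b) (S j), p j ≤ 1 / 8 := by
    intro b
    rw [sum_filter, Fintype.sum_sum_type, Fintype.sum_prod_type]
    exact (sum_meeting_le N D a c ha hc (fun b => by rw [hN]; exact hk) hdeg b).trans hbound
  have hsum : ∀ i, ∑ j with ¬Disjoint (S i) (S j), p j ≤ 1 / 4 := by
    rintro (b | ⟨b, b'⟩)
    · exact (hedge b).trans (by norm_num)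
    · have h1 : (univ.filter fun j => ¬Disjoint (N b ∪ N b') (S j)) ⊆
          (univ.filter fun j => ¬Disjoint (N b) (S j)) ∪
            univ.filter fun j => ¬Disjoint (N b') (S j) := by
        intro j
        simp only [mem_filter, mem_univ, true_and, mem_union, disjoint_union_left]
        tauto
      have h2 := sum_le_sum_of_subset_of_nonneg h1 fun j _ _ => hp0 j
      have h3 := sum_union_inter (f := p) (s₁ := univ.filter fun j => ¬Disjoint (N b) (S j))
        (s₂ := univ.filter fun j => ¬Disjoint (N b') (S j))
      have h4 := sum_nonneg fun j (_ : j ∈ (univ.filter fun j => ¬Disjoint (N b) (S j)) ∩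
        univ.filter fun j => ¬Disjoint (N b') (S j)) => hp0 j
      exact h2.trans (by linarith [hedge b, hedge b'])
  have hSne : ∀ i, (S i).Nonempty := by
    have hne : ∀ b, (N b).Nonempty := fun b => card_pos.1 (by rw [hN]; omega)
    rintro (b | q)
    · exact hne b
    · exact (hne q.1).mono subset_union_left
  have hp1 : ∀ i, p i < 1 / 2 := by
    intro i
    have h1 := single_le_sum (f := p) (fun j _ => hp0 j)
      (show i ∈ univ.filter fun j => ¬Disjoint (S i) (S j) by
        simpa [disjoint_self_iff_empty] using (hSne i).ne_empty)
    linarith [hsum i]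
  obtain ⟨w, hw⟩ := exists_forall_notMem_of_sum_le A S p hp0 hp1 (by
      rintro (b | q) w w' h
      · simp only [A, Sum.elim_inl, mem_filter, mem_univ, true_and]
        rintro (h1 | h1)
        · exact Or.inl fun v hv => h v hv ▸ h1 v hv
        · exact Or.inr fun v hv => h v hv ▸ h1 v hv
      · simp only [S, Sum.elim_inr, mem_union] at h
        simp only [A, Sum.elim_inr]
        split_ifs with h1
        · simp only [mem_filter, mem_univ, true_and, mem_inter]
          rintro ⟨v, hv, h2, h3, h4, h5⟩
          have hvv := h v (Or.inl hv.1)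
          refine ⟨v, hv, hvv ▸ h2, hvv ▸ h3, fun u hu => ?_, fun u hu => ?_⟩
          · rw [← hvv, ← h u (Or.inl hu)]
            exact h4 u hu
          · rw [← hvv, ← h u (Or.inr hu)]
            exact h5 u hu
        · simp) (by
      rintro (b | q)
      · exact card_filter_extreme_div_le k m s hm hs (N b) (hN b)
      · simp only [A, p, Sum.elim_inr]
        split_ifs with h1
        · exact card_filter_conflict_div_le k m s hm (N q.1) (N q.2) h1 (hN _) (hN _)
        · simp) hsum
  refine exists_two_coloring_of_weight N (fun v => (w v).val) (fun b => by rw [hN]; exact hk) ?_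
  intro b b' v hv hmax hmin
  have h1 := hw (Sum.inl b)
  have h2 := hw (Sum.inl b')
  have h3 := hw (Sum.inr (b, b'))
  simp only [A, Sum.elim_inl, Sum.elim_inr, hv, card_singleton, if_true, mem_filter, mem_univ,
    true_and, mem_singleton, exists_eq_left] at h1 h2 h3
  rw [not_or] at h1 h2
  rcases lt_or_ge (w v).val (m - s) with h4 | h4
  · exact h1.1 fun u hu => (hmax u hu).trans_lt h4
  rcases lt_or_ge (w v).val (m + s) with h5 | h5
  · exact h3 ⟨h4, h5, hmax, hmin⟩
  · exact h2.2 fun u hu => h5.trans (hmin u hu)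

/-- The numerical estimate behind the constant `0.17`. -/
theorem exists_weights_bound (k : ℕ) (hL : 10000 ≤ Real.log k) :
    ∃ m s : ℕ, 0 < m ∧ s ≤ m ∧
      (0.17 * Real.sqrt (k / Real.log k) * 2 ^ k + 1) *
          (2 * (((m : ℝ) - s) / (2 * m)) ^ k) +
        2 * ((0.17 * Real.sqrt (k / Real.log k) * 2 ^ k + 1) *
          (0.17 * Real.sqrt (k / Real.log k) * 2 ^ k) *
          ((s : ℝ) / m * ((2 * m + 1) / (4 * m)) ^ (2 * (k - 1)))) ≤ 1 / 8 := by
  have hk0 : (0 : ℝ) < k := by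
    rcases Nat.eq_zero_or_pos k with rfl | h
    · norm_num at hL
    · exact_mod_cast h
  have hk1 : 1 ≤ k := by exact_mod_cast hk0
  set L := Real.log k with hLdef
  have hL0 : 0 < L := by linarith
  have hLk : L + 1 ≤ k := by
    have := Real.add_one_le_exp L
    rwa [hLdef, Real.exp_log hk0] at this
  have hk : (10000 : ℝ) ≤ k := by linarith
  set r := Real.sqrt (k / L) with hr
  have hr2 : r ^ 2 = k / L := Real.sq_sqrt (by positivity)
  have hr1 : 1 ≤ r := by
    rw [hr, Real.one_le_sqrt, one_le_div hL0]
    linarith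
  have h2k : (k : ℝ) ≤ 2 ^ k := by exact_mod_cast (Nat.lt_two_pow_self (n := k)).le
  have hD : 0.17 * r * 2 ^ k + 1 ≤ 0.171 * r * 2 ^ k := by
    nlinarith [mul_le_mul hr1 (hk.trans h2k) (by norm_num) (by linarith)]
  refine ⟨k ^ 2, ⌈k * L / 2⌉₊, by positivity, ?_, ?_⟩
  · rw [Nat.ceil_le]
    push_cast
    nlinarith
  set s := ⌈k * L / 2⌉₊ with hs
  have hs1 : k * L / 2 ≤ s := Nat.le_ceil _
  have hs2 : (s : ℝ) ≤ k * L / 2 + 1 := (Nat.ceil_lt_add_one (by positivity)).le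
  have hsm : (s : ℝ) ≤ k ^ 2 := by nlinarith
  push_cast
  have hE1 : (((k : ℝ) ^ 2 - s) / (2 * k ^ 2)) ^ k ≤ 1 / (Real.sqrt k * 2 ^ k) := by
    have h1 : ((k : ℝ) ^ 2 - s) / (2 * k ^ 2) ≤ Real.exp (-(L / (2 * k))) / 2 := by
      have h2 := Real.one_sub_le_exp_neg (L / (2 * k))
      have h3 : ((k : ℝ) ^ 2 - s) / (2 * k ^ 2) ≤ (1 - L / (2 * k)) / 2 := by
        rw [div_le_div_iff₀ (by positivity) (by norm_num)]
        have h4 : (1 - L / (2 * k)) * (2 * (k : ℝ) ^ 2) = 2 * k ^ 2 - k * L := by field_simp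
        rw [h4]
        linarith
      linarith
    have h5 : (Real.exp (-(L / (2 * k))) / 2) ^ k = 1 / (Real.sqrt k * 2 ^ k) := by
      rw [div_pow, ← Real.exp_nat_mul]
      have h6 : (k : ℝ) * -(L / (2 * k)) = -(L / 2) := by field_simp
      rw [h6, Real.exp_neg, Real.exp_half, hLdef, Real.exp_log hk0]
      field_simp
    rw [← h5]
    exact pow_le_pow_left₀ (div_nonneg (by linarith) (by positivity)) h1 k
  have hE2 : ((2 * (k : ℝ) ^ 2 + 1) / (4 * k ^ 2)) ^ (2 * (k - 1)) ≤ 4.04 / (2 ^ k * 2 ^ k) := by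
    have h1 : (2 * (k : ℝ) ^ 2 + 1) / (4 * k ^ 2) ≤ Real.exp (1 / (2 * k ^ 2)) / 2 := by
      have h2 := Real.add_one_le_exp (1 / (2 * (k : ℝ) ^ 2))
      have h3 : (2 * (k : ℝ) ^ 2 + 1) / (4 * k ^ 2) = (1 / (2 * (k : ℝ) ^ 2) + 1) / 2 := by
        field_simp
        ring
      linarith
    have h4 : Real.exp (1 / (2 * (k : ℝ) ^ 2)) ^ (2 * (k - 1)) ≤ 1.01 := by
      rw [← Real.exp_nat_mul]
      push_cast [Nat.cast_sub hk1]
      have h5 : 2 * ((k : ℝ) - 1) * (1 / (2 * k ^ 2)) ≤ 1 / k := by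
        rw [mul_one_div, div_le_div_iff₀ (by positivity) (by positivity)]
        nlinarith
      have h6 : (1 : ℝ) / k ≤ 0.0001 := by
        rw [div_le_iff₀ hk0]
        linarith
      have h7 := Real.one_sub_le_exp_neg (0.0001 : ℝ)
      have h8 : Real.exp (2 * ((k : ℝ) - 1) * (1 / (2 * k ^ 2))) ≤ Real.exp 0.0001 :=
        Real.exp_le_exp.2 (h5.trans h6)
      have h9 : Real.exp 0.0001 * Real.exp (-0.0001) = 1 := by
        rw [← Real.exp_add]
        norm_num
      have h10 := Real.exp_pos 0.0001
      nlinarith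
    calc ((2 * (k : ℝ) ^ 2 + 1) / (4 * k ^ 2)) ^ (2 * (k - 1))
        ≤ (Real.exp (1 / (2 * k ^ 2)) / 2) ^ (2 * (k - 1)) := by gcongr
      _ = Real.exp (1 / (2 * k ^ 2)) ^ (2 * (k - 1)) * (4 / (2 ^ k * 2 ^ k)) := by
          obtain ⟨j, hj⟩ := Nat.exists_eq_add_of_le' hk1
          rw [div_pow, div_eq_mul_inv]
          congr 1
          rw [hj, add_tsub_cancel_right, ← pow_add,
            show j + 1 + (j + 1) = 2 * j + 2 by ring, pow_add]
          field_simp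
          norm_num
      _ ≤ 1.01 * (4 / (2 ^ k * 2 ^ k)) := by gcongr
      _ = _ := by ring
  have hF1 : (0.17 * r * 2 ^ k + 1) * (2 * (((k : ℝ) ^ 2 - s) / (2 * k ^ 2)) ^ k) ≤ 0.004 := by
    have h1 : (0.17 * r * 2 ^ k + 1) * (2 * (((k : ℝ) ^ 2 - s) / (2 * k ^ 2)) ^ k) ≤
        0.171 * r * 2 ^ k * (2 * (1 / (Real.sqrt k * 2 ^ k))) := by gcongr
    have h2 : r = Real.sqrt k / Real.sqrt L := Real.sqrt_div hk0.le L
    have h3 : 0 < Real.sqrt k := Real.sqrt_pos.2 hk0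
    have h4 : (100 : ℝ) ≤ Real.sqrt L := Real.le_sqrt_of_sq_le (by linarith)
    have h5 : 0.171 * r * 2 ^ k * (2 * (1 / (Real.sqrt k * 2 ^ k))) = 0.342 / Real.sqrt L := by
      rw [h2]
      field_simp
      norm_num
    rw [h5] at h1
    refine h1.trans ?_
    rw [div_le_iff₀ (by linarith)]
    linarith
  have hF2 : (0.17 * r * 2 ^ k + 1) * (0.17 * r * 2 ^ k) *
      ((s : ℝ) / k ^ 2 * ((2 * k ^ 2 + 1) / (4 * k ^ 2)) ^ (2 * (k - 1))) ≤ 0.06 := by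
    calc (0.17 * r * 2 ^ k + 1) * (0.17 * r * 2 ^ k) *
        ((s : ℝ) / k ^ 2 * ((2 * k ^ 2 + 1) / (4 * k ^ 2)) ^ (2 * (k - 1)))
        ≤ (0.171 * r * 2 ^ k) * (0.17 * r * 2 ^ k) *
          ((k * L / 2 + 1) / k ^ 2 * (4.04 / (2 ^ k * 2 ^ k))) := by gcongr
      _ = 0.171 * 0.17 * 4.04 * (r ^ 2 * ((k * L / 2 + 1) / k ^ 2)) := by field_simp
      _ = 0.171 * 0.17 * 4.04 * (1 / 2 + 1 / (k * L)) := by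
          rw [hr2]
          field_simp
      _ ≤ 0.171 * 0.17 * 4.04 * (1 / 2 + 0.001) := by
          gcongr
          rw [div_le_iff₀ (by positivity)]
          nlinarith
      _ ≤ 0.06 := by norm_num
  linarith

/-- Labeling each edge by the color of its endpoint in `A` distinguishes neighbors, provided that
every vertex of `B` sees both colors. -/
theorem exists_labeling_of_two_coloring {V : Type} [Fintype V] [DecidableEq V]
    (G : SimpleGraph V) [DecidableRel G.Adj] (A B : Set V) (hAB : ∀ v, v ∈ A ↔ v ∉ B)
    (hG : ∀ u v, G.Adj u v → (u ∈ A ∧ v ∈ B) ∨ (u ∈ B ∧ v ∈ A)) (f : V → Fin 2)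
    (hf : ∀ b ∈ B, ∀ i : Fin 2, ∃ a, G.Adj b a ∧ f a = i) :
    ∃ c : Sym2 V → Fin 2, ∀ u v, G.Adj u v →
      (G.incidenceFinset u).image c ≠ (G.incidenceFinset v).image c := by
  classical
  let c : Sym2 V → Fin 2 := fun e => if ∃ a ∈ A, a ∈ e ∧ f a = 1 then 1 else 0
  have hc : ∀ a ∈ A, ∀ b ∈ B, c s(a, b) = f a := by
    intro a ha b hb
    have hb' : b ∉ A := fun h => (hAB b).1 h hb
    have hiff : (∃ x ∈ A, x ∈ s(a, b) ∧ f x = 1) ↔ f a = 1 := by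
      constructor
      · rintro ⟨x, hx, hxe, hfx⟩
        rcases Sym2.mem_iff.1 hxe with rfl | rfl
        exacts [hfx, absurd hx hb']
      · exact fun h => ⟨a, ha, Sym2.mem_mk_left a b, h⟩
    simp only [c, hiff]
    split_ifs with h
    · exact h.symm
    · omega
  have key : ∀ a ∈ A, ∀ b ∈ B,
      (G.incidenceFinset a).image c ≠ (G.incidenceFinset b).image c := by
    intro a ha b hb h
    obtain ⟨a', hba', hfa'⟩ := hf b hb (1 - f a)
    have ha' : a' ∈ A := by
      rcases hG b a' hba' with h1 | h1
      · exact absurd hb ((hAB b).1 h1.1)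
      · exact h1.2
    have hmem : 1 - f a ∈ (G.incidenceFinset b).image c := by
      refine Finset.mem_image.2 ⟨s(a', b), ?_, by rw [hc a' ha' b hb, hfa']⟩
      rw [SimpleGraph.mem_incidenceFinset, Sym2.eq_swap]
      exact (G.mem_incidence_iff_neighbor).2 hba'
    rw [← h, Finset.mem_image] at hmem
    obtain ⟨e, he, hce⟩ := hmem
    rw [SimpleGraph.mem_incidenceFinset] at he
    obtain ⟨b', rfl⟩ := Sym2.mem_iff_exists.1 he.2
    have hab' : G.Adj a b' := (G.mem_incidence_iff_neighbor).1 he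
    have hb' : b' ∈ B := by
      rcases hG a b' hab' with h1 | h1
      · exact h1.2
      · exact absurd h1.1 ((hAB a).1 ha)
    rw [hc a ha b' hb'] at hce
    omega
  refine ⟨c, fun u v huv => ?_⟩
  rcases hG u v huv with h | h
  · exact key u h.1 v h.2
  · exact (key v h.2 u h.1).symm

/-- In a bipartite graph, distinct vertices of the same class with a common neighbor are at
distance two. -/
theorem dist_eq_two_of_common_neighbor {V : Type*} (G : SimpleGraph V) (A B : Set V)
    (hAB : ∀ v, v ∈ A ↔ v ∉ B)
    (hG : ∀ u v, G.Adj u v → (u ∈ A ∧ v ∈ B) ∨ (u ∈ B ∧ v ∈ A)) {b b' a : V} (hb : b ∈ B)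
    (hb' : b' ∈ B) (hne : b' ≠ b) (h : G.Adj b a) (h' : G.Adj b' a) : G.dist b b' = 2 := by
  let p : G.Walk b b' := .cons h (.cons h'.symm .nil)
  have h2 : G.dist b b' ≤ 2 := SimpleGraph.dist_le p
  have h0 : 0 < G.dist b b' := p.reachable.pos_dist_of_ne hne.symm
  have h1 : G.dist b b' ≠ 1 := by
    rw [Ne, SimpleGraph.dist_eq_one_iff_adj]
    intro hadj
    rcases hG b b' hadj with h3 | h3
    · exact (hAB b).1 h3.1 hb
    · exact (hAB b').1 h3.2 hb'
  omega

open Finset in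
/-- Vertices of `B` with intersecting (parts of) neighborhoods are counted by distance two. -/
theorem card_meeting_le_ncard_dist_two {V : Type*} [Fintype V] [DecidableEq V]
    (G : SimpleGraph V) [DecidableRel G.Adj] (A B : Set V) [Fintype B]
    (hAB : ∀ v, v ∈ A ↔ v ∉ B)
    (hG : ∀ u v, G.Adj u v → (u ∈ A ∧ v ∈ B) ∨ (u ∈ B ∧ v ∈ A)) (N : B → Finset V)
    (hN : ∀ b, N b ⊆ G.neighborFinset b) (b : B) :
    #{b' | b' ≠ b ∧ ¬Disjoint (N b) (N b')} ≤ Set.ncard {u : V | G.dist b u = 2} := by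
  rw [← Set.ncard_coe_finset]
  refine Set.ncard_le_ncard_of_injOn Subtype.val ?_ Subtype.val_injective.injOn (Set.toFinite _)
  intro b' hb'
  obtain ⟨hne, hmeet⟩ : b' ≠ b ∧ ¬Disjoint (N b) (N b') := by simpa using hb'
  obtain ⟨a, ha, ha'⟩ := not_disjoint_iff.1 hmeet
  exact dist_eq_two_of_common_neighbor G A B hAB hG b.2 b'.2 (fun e => hne (Subtype.ext e))
    ((G.mem_neighborFinset _ _).1 (hN _ ha)) ((G.mem_neighborFinset _ _).1 (hN _ ha'))

/-- Let `G` be a bipartite graph with classes `A`, `B` where every vertex of `B` has degree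
at least `k`.  If for every `b ∈ B` the number of vertices at distance exactly `2` from `b`
is at most `2^{k-1}/e - 1`, then `G` has an edge labeling with two labels distinguishing
neighbors by sets (i.e. `gndi(G) = 2` when `G` has an edge).  Moreover, if every `b ∈ B`
has degree exactly `k` and `k` is sufficiently large, the bound on the number of vertices
at distance `2` can be improved to `0.17 √(k/ln k) 2^k`. -/
theorem bipartite_gndi_two_of_dist_two_bound :
    (∀ (V : Type) [Fintype V] [DecidableEq V] (G : SimpleGraph V) [DecidableRel G.Adj]
        (A B : Set V) (k : ℕ),
      (∀ v : V, v ∈ A ↔ v ∉ B) →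
      (∀ u v : V, G.Adj u v → (u ∈ A ∧ v ∈ B) ∨ (u ∈ B ∧ v ∈ A)) →
      (∀ b ∈ B, k ≤ G.degree b) →
      (∀ b ∈ B, ((Set.ncard {u : V | G.dist b u = 2}) : ℝ) ≤
        2 ^ (k - 1) / Real.exp 1 - 1) →
      ∃ c : Sym2 V → Fin 2, ∀ u v : V, G.Adj u v →
        (G.incidenceFinset u).image c ≠ (G.incidenceFinset v).image c) ∧
    (∃ k₀ : ℕ, ∀ (V : Type) [Fintype V] [DecidableEq V] (G : SimpleGraph V)
        [DecidableRel G.Adj] (A B : Set V) (k : ℕ), k₀ ≤ k →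
      (∀ v : V, v ∈ A ↔ v ∉ B) →
      (∀ u v : V, G.Adj u v → (u ∈ A ∧ v ∈ B) ∨ (u ∈ B ∧ v ∈ A)) →
      (∀ b ∈ B, G.degree b = k) →
      (∀ b ∈ B, ((Set.ncard {u : V | G.dist b u = 2}) : ℝ) ≤
        0.17 * Real.sqrt ((k : ℝ) / Real.log (k : ℝ)) * 2 ^ k) →
      ∃ c : Sym2 V → Fin 2, ∀ u v : V, G.Adj u v →
        (G.incidenceFinset u).image c ≠ (G.incidenceFinset v).image c) := by
  classical
  constructor
  · intro V _ _ G _ A B k hAB hG hdeg hdist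
    have hsub : ∀ b : B, ∃ T ⊆ G.neighborFinset b, T.card = k := fun b =>
      Finset.exists_subset_card_eq (hdeg b b.2)
    choose N hN hNk using hsub
    obtain ⟨f, hf⟩ := exists_two_coloring_of_exp N k hNk fun b =>
      (Nat.cast_le.2 (card_meeting_le_ncard_dist_two G A B hAB hG N hN b)).trans (hdist b b.2)
    refine exists_labeling_of_two_coloring G A B hAB hG f fun b hb i => ?_
    obtain ⟨a, ha, hfa⟩ := hf ⟨b, hb⟩ i
    exact ⟨a, (G.mem_neighborFinset _ _).1 (hN _ ha), hfa⟩
  · refine ⟨⌈Real.exp 10000⌉₊, ?_⟩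
    intro V _ _ G _ A B k hk hAB hG hdeg hdist
    have hL : 10000 ≤ Real.log k := by
      have h1 : Real.exp 10000 ≤ k := Nat.ceil_le.1 hk
      rwa [Real.le_log_iff_exp_le ((Real.exp_pos _).trans_le h1)]
    have hk2 : 2 ≤ k := by
      by_contra! h
      interval_cases k <;> norm_num at hL
    obtain ⟨m, s, hm, hs, hbound⟩ := exists_weights_bound k hL
    obtain ⟨f, hf⟩ := exists_two_coloring_of_greedy (fun b : B => G.neighborFinset b) k m s _ hk2
      hm hs (fun b => hdeg b b.2) (fun b =>
        (Nat.cast_le.2 (card_meeting_le_ncard_dist_two G A B hAB hG _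
          (fun _ => subset_rfl) b)).trans (hdist b b.2)) hbound
    refine exists_labeling_of_two_coloring G A B hAB hG f fun b hb i => ?_
    obtain ⟨a, ha, hfa⟩ := hf ⟨b, hb⟩ i
    exact ⟨a, (G.mem_neighborFinset _ _).1 ha, hfa⟩
end

section
/- For every k ≥ 4, every k-regular bipartite graph G satisfies gndi(G) = 2, i.e., G admits an edge labeling with two labels distinguishing neighbors by sets. -/
namespace SignMatrix

open Finset

variable {ι κ : Type} [Fintype ι] [Fintype κ] [DecidableEq ι] [DecidableEq κ]

set_option linter.unusedSectionVars false

open Classical in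
/-- The columns in which some row of `S` has a nonzero entry. -/
noncomputable def nb (M : Matrix ι κ ℝ) (S : Finset ι) : Finset κ :=
  Finset.univ.filter fun b => ∃ a ∈ S, M a b ≠ 0

/-- `V` arises from `M` by rescaling every entry by a nonnegative factor. -/
def Dominated (V M : Matrix ι κ ℝ) : Prop :=
  ∀ a b, ∃ l : ℝ, 0 ≤ l ∧ V a b = l * M a b

/-- The support of `V` contains a matching covering all rows. -/
def HasMatching (V : Matrix ι κ ℝ) : Prop :=
  ∃ σ : ι → κ, Function.Injective σ ∧ ∀ a, V a (σ a) ≠ 0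

/-- Every matrix dominated by `M` whose support has a perfect matching is nonsingular. -/
def SignNonsingular (M : Matrix ι κ ℝ) : Prop :=
  ∀ V, Dominated V M → HasMatching V → ∀ u : ι → ℝ, Matrix.vecMul u V = 0 → u = 0

/-- The support of `M` is connected and all its edges lie in perfect matchings. -/
def MatchingCovered (M : Matrix ι κ ℝ) : Prop :=
  ∀ S : Finset ι, S.Nonempty → S ≠ Finset.univ → S.card + 1 ≤ (nb M S).card

/-- The support of `M` is a brace. -/
def Brace (M : Matrix ι κ ℝ) : Prop :=
  ∀ S : Finset ι, S.Nonempty → S.card + 2 ≤ Fintype.card ι → S.card + 2 ≤ (nb M S).card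

open Classical in
/-- The rows with at most three nonzero entries. -/
noncomputable def low (M : Matrix ι κ ℝ) : Finset ι :=
  Finset.univ.filter fun a => (nb M {a}).card ≤ 3

lemma mem_nb {M : Matrix ι κ ℝ} {S : Finset ι} {b : κ} :
    b ∈ nb M S ↔ ∃ a ∈ S, M a b ≠ 0 := by
  simp [nb]

lemma mem_low {M : Matrix ι κ ℝ} {a : ι} : a ∈ low M ↔ #(nb M {a}) ≤ 3 := by
  simp [low]

lemma nb_mono (M : Matrix ι κ ℝ) {S T : Finset ι} (h : S ⊆ T) : nb M S ⊆ nb M T := by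
  intro b
  simp only [mem_nb]
  rintro ⟨a, ha, hb⟩
  exact ⟨a, h ha, hb⟩

lemma nb_union (M : Matrix ι κ ℝ) (S T : Finset ι) : nb M (S ∪ T) = nb M S ∪ nb M T := by
  ext b
  simp only [mem_nb, mem_union, or_and_right, exists_or]

lemma nb_inter_subset (M : Matrix ι κ ℝ) (S T : Finset ι) :
    nb M (S ∩ T) ⊆ nb M S ∩ nb M T :=
  subset_inter (nb_mono M inter_subset_left) (nb_mono M inter_subset_right)

lemma exists_matching_into (M : Matrix ι κ ℝ) (Z : Finset ι) (Y : Finset κ)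
    (h : ∀ R ⊆ Z, R.Nonempty → #R ≤ #(nb M R ∩ Y)) :
    ∃ σ : {a // a ∈ Z} → κ, Function.Injective σ ∧ ∀ a, σ a ∈ Y ∧ M a (σ a) ≠ 0 := by
  have := (Finset.all_card_le_biUnion_card_iff_exists_injective
    (fun a : {a // a ∈ Z} => nb M {a.1} ∩ Y)).1 (fun s => by
      rcases s.eq_empty_or_nonempty with rfl | hs
      · simp
      have h1 := h (s.map (Function.Embedding.subtype _)) (by
        intro a ha
        simp only [mem_map, Function.Embedding.subtype_apply] at ha
        obtain ⟨x, -, rfl⟩ := ha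
        exact x.2) (by simpa using hs)
      rw [card_map] at h1
      refine h1.trans (card_le_card ?_)
      intro b hb
      simp only [mem_inter, mem_nb, mem_map, Function.Embedding.subtype_apply] at hb
      obtain ⟨⟨_, ⟨x, hx, rfl⟩, hxb⟩, hY⟩ := hb
      simp only [mem_biUnion, mem_inter, mem_nb, mem_singleton, exists_eq_left]
      exact ⟨x, hx, hxb, hY⟩)
  obtain ⟨σ, hσ, h2⟩ := this
  refine ⟨σ, hσ, fun a => ?_⟩
  have := h2 a
  simp only [mem_inter, mem_nb, mem_singleton, exists_eq_left] at this
  exact ⟨this.2, this.1⟩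

lemma hasMatching_of_parts (V : Matrix ι κ ℝ) (Z : Finset ι) (Y : Finset κ)
    (σ : {a // a ∈ Z} → κ) (hσ : Function.Injective σ) (h : ∀ a, σ a ∈ Y ∧ V a (σ a) ≠ 0)
    (τ : {a // a ∈ Zᶜ} → κ) (hτ : Function.Injective τ)
    (h' : ∀ a, τ a ∉ Y ∧ V a (τ a) ≠ 0) : HasMatching V := by
  refine ⟨fun a => if ha : a ∈ Z then σ ⟨a, ha⟩ else τ ⟨a, by simpa using ha⟩, ?_, ?_⟩
  · intro a a' haa
    by_cases ha : a ∈ Z <;> by_cases ha' : a' ∈ Z <;> simp only [ha, ha', dite_true, dite_false] at haa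
    · simpa using hσ haa
    · exact absurd (haa ▸ (h ⟨a, ha⟩).1) (h' _).1
    · exact absurd (haa ▸ (h ⟨a', ha'⟩).1) (h' _).1
    · simpa using hτ haa
  · intro a
    by_cases ha : a ∈ Z <;> simp only [ha, dite_true, dite_false]
    · exact (h ⟨a, ha⟩).2
    · exact (h' ⟨a, _⟩).2

lemma Dominated.trans {U V M : Matrix ι κ ℝ} (h : Dominated U V) (h' : Dominated V M) :
    Dominated U M := by
  intro a b
  obtain ⟨l, hl, e⟩ := h a b
  obtain ⟨l', hl', e'⟩ := h' a b
  exact ⟨l * l', mul_nonneg hl hl', by rw [e, e', mul_assoc]⟩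

lemma SignNonsingular.of_dominated {V M : Matrix ι κ ℝ} (hM : SignNonsingular M)
    (h : Dominated V M) : SignNonsingular V :=
  fun U hU => hM U (hU.trans h)

lemma mulVec_injective_of_vecMul (h : Fintype.card ι = Fintype.card κ) (W : Matrix ι κ ℝ)
    (hW : ∀ u : ι → ℝ, Matrix.vecMul u W = 0 → u = 0) (x : κ → ℝ)
    (hx : W.mulVec x = 0) : x = 0 := by
  have hinj : Function.Injective (Matrix.vecMulLinear W) := by
    rw [← LinearMap.ker_eq_bot, LinearMap.ker_eq_bot']
    exact fun u hu => hW u hu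
  have hsurj : Function.Surjective (Matrix.vecMulLinear W) :=
    (LinearMap.injective_iff_surjective_of_finrank_eq_finrank (by simp [h])).1 hinj
  obtain ⟨u, hu⟩ := hsurj x
  have hu : Matrix.vecMul u W = x := hu
  have h1 : x ⬝ᵥ x = 0 := by
    nth_rw 1 [← hu]
    rw [← Matrix.dotProduct_mulVec, hx, dotProduct_zero]
  exact dotProduct_self_eq_zero.1 h1

lemma HasMatching.transpose (h : Fintype.card ι = Fintype.card κ) {V : Matrix ι κ ℝ}
    (hV : HasMatching V) : HasMatching V.transpose := by
  obtain ⟨σ, hσ, h1⟩ := hV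
  let e := Equiv.ofBijective σ ((Fintype.bijective_iff_injective_and_card σ).2 ⟨hσ, h⟩)
  refine ⟨e.symm, e.symm.injective, fun b => ?_⟩
  have := h1 (e.symm b)
  have e1 : σ (e.symm b) = b := e.apply_symm_apply b
  rw [e1] at this
  exact this

lemma SignNonsingular.transpose (h : Fintype.card ι = Fintype.card κ) {M : Matrix ι κ ℝ}
    (hM : SignNonsingular M) : SignNonsingular M.transpose := by
  intro V hV hm x hx
  refine mulVec_injective_of_vecMul h V.transpose
    (hM V.transpose (fun a b => hV b a) (hm.transpose h.symm)) x ?_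
  rw [Matrix.mulVec_transpose, hx]

lemma SignNonsingular.four_cycle_neg {M : Matrix ι κ ℝ} (hM : SignNonsingular M) (hB : Brace M)
    {f r : ι} {p q : κ} (hfr : f ≠ r) (hpq : p ≠ q) (hfp : M f p ≠ 0) (hfq : M f q ≠ 0)
    (hrp : M r p ≠ 0) (hrq : M r q ≠ 0) : M f p * M f q * (M r p * M r q) < 0 := by
  by_contra! hneg
  set t := M f p * M r p with ht
  have ht0 : t ≠ 0 := mul_ne_zero hfp hrp
  set V : Matrix ι κ ℝ := fun a b =>
    if b = p ∨ b = q then (if a = f then M f b else if a = r then t * M f b else 0)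
    else if a = f ∨ a = r then 0 else M a b with hV
  have hdom : Dominated V M := by
    intro a b
    by_cases hb : b = p ∨ b = q
    · by_cases haf : a = f
      · exact ⟨1, zero_le_one, by simp [hV, hb, haf]⟩
      by_cases har : a = r
      · subst har
        rcases hb with rfl | rfl
        · exact ⟨M f b ^ 2, by positivity, by simp [hV, haf, ht]; ring⟩
        · refine ⟨M f p * M f b * (M a p * M a b) / M a b ^ 2, by positivity, ?_⟩
          simp only [hV, haf, ht, or_true, if_true, if_false]
          field_simp
      · exact ⟨0, le_rfl, by simp [hV, hb, haf, har]⟩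
    · by_cases ha : a = f ∨ a = r
      · exact ⟨0, le_rfl, by simp [hV, hb, ha]⟩
      · exact ⟨1, zero_le_one, by simp [hV, hb, ha]⟩
  have hmatch : HasMatching V := by
    obtain ⟨τ, hτ, h'⟩ := exists_matching_into M ({f, r}ᶜ) ({p, q}ᶜ) (by
      intro R hR hne
      have h2 : #R + 2 ≤ Fintype.card ι := by
        have := card_le_card hR
        rw [card_compl, card_pair hfr] at this
        have h3 := card_le_univ ({f, r} : Finset ι)
        rw [card_pair hfr] at h3
        omega
      have h3 := hB R hne h2
      have h4 := card_sdiff_add_card_inter (nb M R) {p, q}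
      rw [sdiff_eq_inter_compl] at h4
      have h5 := card_le_card (inter_subset_right : nb M R ∩ {p, q} ⊆ {p, q})
      rw [card_pair hpq] at h5
      omega)
    refine hasMatching_of_parts V {f, r} {p, q} (fun a => if a = f then p else q) ?_ ?_ τ hτ ?_
    · rintro ⟨a, ha⟩ ⟨a', ha'⟩ haa
      simp only [mem_insert, mem_singleton] at ha ha'
      simp only [Subtype.mk.injEq]
      have hrf := hfr.symm
      have hqp := hpq.symm
      rcases ha with rfl | rfl <;> rcases ha' with rfl | rfl <;> simp_all
    · rintro ⟨a, ha⟩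
      simp only [mem_insert, mem_singleton] at ha
      rcases ha with rfl | rfl
      · simpa [hV] using hfp
      · simp [hV, hfr.symm, ht0, hfq]
    · rintro ⟨a, ha⟩
      have h6 := h' ⟨a, ha⟩
      simp only [mem_compl, mem_insert, mem_singleton] at ha h6
      simp [hV, h6.1, ha, h6.2]
  have h0 := hM V hdom hmatch (fun a => if a = f then -t else if a = r then 1 else 0) (by
    ext b
    rw [Matrix.vecMul, dotProduct]
    rw [Fintype.sum_eq_add f r hfr]
    · by_cases hb : b = p ∨ b = q <;> simp [hV, hb, hfr.symm]
    · rintro a ⟨h1, h2⟩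
      simp [h1, h2])
  have := congrFun h0 r
  simp [hfr.symm] at this

lemma SignNonsingular.no_three_common {M : Matrix ι κ ℝ} (hM : SignNonsingular M)
    (hB : Brace M) {f r s : ι} {p q : κ} (hfr : f ≠ r) (hfs : f ≠ s) (hrs : r ≠ s) (hpq : p ≠ q)
    (hfp : M f p ≠ 0) (hfq : M f q ≠ 0) (hrp : M r p ≠ 0) (hrq : M r q ≠ 0)
    (hsp : M s p ≠ 0) (hsq : M s q ≠ 0) : False := by
  have h1 := hM.four_cycle_neg hB hfr hpq hfp hfq hrp hrq
  have h2 := hM.four_cycle_neg hB hfs hpq hfp hfq hsp hsq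
  have h3 := hM.four_cycle_neg hB hrs hpq hrp hrq hsp hsq
  generalize M f p * M f q = x at *
  generalize M r p * M r q = y at *
  generalize M s p * M s q = z at *
  have h4 := mul_pos_of_neg_of_neg h1 h2
  nlinarith [mul_nonneg (sq_nonneg x) (neg_nonneg.2 h3.le)]

lemma MatchingCovered.nb_univ (hc : Fintype.card ι = Fintype.card κ) {M : Matrix ι κ ℝ}
    (hM : MatchingCovered M) (h2 : 2 ≤ Fintype.card ι) : nb M univ = univ := by
  have : Nonempty ι := Fintype.card_pos_iff.1 (by omega)
  obtain ⟨a⟩ := this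
  have h1 := hM {a}ᶜ (by
    rw [← card_pos, card_compl, card_singleton]; omega) (by
    intro h
    have := congrArg card h
    rw [card_compl, card_singleton, card_univ] at this
    omega)
  rw [card_compl, card_singleton] at h1
  have h3 := card_le_card (nb_mono M (subset_univ ({a}ᶜ : Finset ι)))
  rw [← card_eq_iff_eq_univ]
  have := card_le_univ (nb M univ)
  omega

lemma sum_eq_sum_coe_add (S : Finset ι) (g : ι → ℝ) :
    ∑ a, g a = ∑ a : {a // a ∈ S}, g a + ∑ a ∈ Sᶜ, g a := by
  rw [Finset.sum_coe_sort, sum_add_sum_compl]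

lemma exists_null_combination (M : Matrix ι κ ℝ) (Z : Finset ι) (T : Finset κ) (h : #T < #Z) :
    ∃ y : ι → ℝ, y ≠ 0 ∧ (∀ a, a ∉ Z → y a = 0) ∧ ∀ t ∈ T, ∑ a, y a * M a t = 0 := by
  let N : Matrix {a // a ∈ Z} {b // b ∈ T} ℝ := fun a b => M a b
  have hk := LinearMap.ker_ne_bot_of_finrank_lt (f := Matrix.vecMulLinear N) (by simpa using h)
  obtain ⟨y, hy, hy0⟩ := (Submodule.ne_bot_iff _).1 hk
  have hy : Matrix.vecMul y N = 0 := hy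
  refine ⟨fun a => if ha : a ∈ Z then y ⟨a, ha⟩ else 0, ?_, ?_, ?_⟩
  · intro h0
    apply hy0
    ext a
    have := congrFun h0 a.1
    simpa using this
  · intro a ha
    simp [ha]
  · intro t ht
    rw [sum_eq_sum_coe_add Z]
    have h1 := congrFun hy ⟨t, ht⟩
    simp only [Matrix.vecMul, dotProduct, N, Pi.zero_apply] at h1
    rw [Finset.sum_eq_zero (s := Zᶜ) (fun a ha => by simp [mem_compl.1 ha]), add_zero]
    simpa using h1

lemma MatchingCovered.exists_matching_compl (hc : Fintype.card ι = Fintype.card κ)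
    {M : Matrix ι κ ℝ} (hM : MatchingCovered M) {S : Finset ι} (hS : S.Nonempty)
    (ht : #(nb M S) = #S + 1) {x : κ} (hx : x ∈ nb M S)
    (hz : ∃ z ∉ S, M z x ≠ 0) :
    ∃ τ : {a // a ∈ Sᶜ} → κ, Function.Injective τ ∧
      ∀ a, τ a ∉ (nb M S).erase x ∧ M a (τ a) ≠ 0 := by
  obtain ⟨τ, hτ, h⟩ := exists_matching_into M Sᶜ ((nb M S).erase x)ᶜ (by
    intro R hR hne
    have hd : Disjoint R S := by
      rw [disjoint_iff_inter_eq_empty]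
      ext a
      have := @hR a
      simp only [mem_compl] at this
      simp
      tauto
    have hcd := card_union_of_disjoint hd
    have hsub : nb M (R ∪ S) ⊆ (nb M R ∩ ((nb M S).erase x)ᶜ) ∪ nb M S := by
      intro b
      simp only [nb_union, mem_union, mem_inter, mem_compl, mem_erase]
      tauto
    by_cases hu : R ∪ S = univ
    · have h2 : 2 ≤ Fintype.card ι := by
        rw [← card_univ, ← hu, hcd]
        have := hne.card_pos
        have := hS.card_pos
        omega
      have h3 := hM.nb_univ hc h2
      rw [← hu, nb_union] at h3
      obtain ⟨z, hzS, hzx⟩ := hz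
      have hzR : z ∈ R := by
        have := mem_univ z
        rw [← hu, mem_union] at this
        tauto
      have : ((nb M S).erase x)ᶜ ⊆ nb M R ∩ ((nb M S).erase x)ᶜ := by
        intro b hb
        rw [mem_inter]
        refine ⟨?_, hb⟩
        rw [mem_compl, mem_erase] at hb
        by_cases hbx : b = x
        · subst hbx
          exact mem_nb.2 ⟨z, hzR, hzx⟩
        · have := mem_univ b
          rw [← h3, mem_union] at this
          tauto
      refine le_trans ?_ (card_le_card this)
      rw [card_compl, card_erase_of_mem hx, ht, ← hc, ← card_univ (α := ι), ← hu, hcd]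
      omega
    · have h1 := hM (R ∪ S) (hne.mono subset_union_left) hu
      have h2 := (card_le_card hsub).trans (card_union_le _ _)
      omega)
  exact ⟨τ, hτ, fun a => ⟨mem_compl.1 (h a).1, (h a).2⟩⟩

lemma MatchingCovered.exists_matching_erase {M : Matrix ι κ ℝ} (hM : MatchingCovered M)
    {S : Finset ι} (hS' : S ≠ univ) (x : κ) :
    ∃ σ : {a // a ∈ S} → κ, Function.Injective σ ∧
      ∀ a, σ a ∈ (nb M S).erase x ∧ M a (σ a) ≠ 0 := by
  refine exists_matching_into M S _ fun R hR hne => ?_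
  have h1 := hM R hne (by
    rintro rfl
    exact hS' (univ_subset_iff.1 hR))
  have : nb M R ∩ (nb M S).erase x = (nb M R).erase x := by
    ext b
    have := @nb_mono _ _ _ _ _ _ M _ _ hR b
    simp only [mem_inter, mem_erase]
    tauto
  rw [this]
  have := pred_card_le_card_erase (s := nb M R) (a := x)
  omega

theorem SignNonsingular.exists_row_contraction (hc : Fintype.card ι = Fintype.card κ)
    {M : Matrix ι κ ℝ} (hG : SignNonsingular M) (hM : MatchingCovered M) {S : Finset ι}
    (hS : S.Nonempty) (hS' : S ≠ univ) (ht : #(nb M S) = #S + 1) :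
    ∃ N : Matrix (Option {a // a ∈ S}) {b // b ∈ nb M S} ℝ, SignNonsingular N ∧
      (∀ a x, N (some a) x = M a x) ∧ ∀ x, N none x ≠ 0 ↔ ∃ z ∉ S, M z x ≠ 0 := by
  obtain ⟨y, hy0, hyS, hy⟩ := exists_null_combination M Sᶜ (nb M S)ᶜ (by
    rw [card_compl, card_compl, ht, ← hc]
    have := (card_lt_iff_ne_univ S).2 hS'
    omega)
  simp only [mem_compl, not_not] at hyS hy
  have hout : ∀ a ∈ S, ∀ b ∉ nb M S, M a b = 0 := by
    intro a ha b hb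
    by_contra h
    exact hb (mem_nb.2 ⟨a, ha, h⟩)
  refine ⟨fun a x => a.elim (∑ z, y z * M z x) (fun a => M a x), ?_, fun a x => rfl, ?_⟩
  · rintro V1 hV1 ⟨σ1, hσ1, hm⟩ u1 hu1
    choose l hl hl' using hV1 none
    simp only [Option.elim] at hl'
    set V : Matrix ι κ ℝ := fun a b =>
      if hb : b ∈ nb M S then
        (if ha : a ∈ S then V1 (some ⟨a, ha⟩) ⟨b, hb⟩ else l ⟨b, hb⟩ * M a b) else M a b with hV
    have hdom : Dominated V M := by
      intro a b
      by_cases hb : b ∈ nb M S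
      · by_cases ha : a ∈ S
        · obtain ⟨c, hc, h⟩ := hV1 (some ⟨a, ha⟩) ⟨b, hb⟩
          exact ⟨c, hc, by simp [hV, hb, ha, h]⟩
        · exact ⟨l ⟨b, hb⟩, hl _, by simp [hV, hb, ha]⟩
      · exact ⟨1, zero_le_one, by simp [hV, hb]⟩
    obtain ⟨x0, hx0⟩ : ∃ x0, x0 = σ1 none := ⟨_, rfl⟩
    have hm0 := hm none
    rw [← hx0, hl'] at hm0
    have hz : ∃ z ∉ S, M z x0 ≠ 0 := by
      by_contra! h
      apply right_ne_zero_of_mul hm0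
      refine sum_eq_zero fun z _ => ?_
      by_cases hz : z ∈ S
      · rw [hyS z hz, zero_mul]
      · rw [h z hz, mul_zero]
    obtain ⟨τ, hτ, h'⟩ := hM.exists_matching_compl hc hS ht x0.2 hz
    have hmatch : HasMatching V := by
      refine hasMatching_of_parts V S ((nb M S).erase x0) (fun a => σ1 (some a)) ?_ ?_ τ hτ ?_
      · intro a a' h
        simpa using hσ1 (Subtype.ext h)
      · rintro a
        refine ⟨mem_erase.2 ⟨?_, (σ1 (some a)).2⟩, ?_⟩
        · rw [hx0]
          intro h
          simpa using hσ1 (Subtype.ext h)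
        · have := hm (some a)
          simp only [hV, a.2, (σ1 (some a)).2, dite_true]
          exact this
      · intro a
        refine ⟨(h' a).1, ?_⟩
        have haS : a.1 ∉ S := mem_compl.1 a.2
        by_cases hb : τ a ∈ nb M S
        · have : τ a = x0 := by
            by_contra hne
            exact (h' a).1 (mem_erase.2 ⟨hne, hb⟩)
          simp only [hV, hb, haS, dite_true, dite_false]
          refine mul_ne_zero ?_ (h' a).2
          have h3 : (⟨τ a, hb⟩ : {b // b ∈ nb M S}) = x0 := Subtype.ext this
          rw [h3]
          exact left_ne_zero_of_mul hm0
        · simp only [hV, hb, dite_false]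
          exact (h' a).2
    have h0 := hG V hdom hmatch (fun a => if ha : a ∈ S then u1 (some ⟨a, ha⟩) else u1 none * y a) (by
      ext b
      simp only [Matrix.vecMul, dotProduct, Pi.zero_apply]
      by_cases hb : b ∈ nb M S
      · have h1 := congrFun hu1 ⟨b, hb⟩
        simp only [Matrix.vecMul, dotProduct, Pi.zero_apply, Fintype.sum_option, hl'] at h1
        have h2 : ∑ z, y z * M z b = ∑ z ∈ Sᶜ, y z * M z b := by
          rw [sum_eq_sum_coe_add S, Finset.sum_eq_zero (s := univ)
            (fun a _ => by rw [hyS a a.2, zero_mul]), zero_add]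
        rw [h2, mul_sum, mul_sum, add_comm] at h1
        rw [sum_eq_sum_coe_add S, ← h1]
        congr 1
        · refine sum_congr rfl fun a _ => ?_
          simp [a.2, hV, hb]
        · refine sum_congr rfl fun a ha => ?_
          simp only [mem_compl.1 ha, dite_false, hV, hb, dite_true]
          ring
      · have h1 := hy b hb
        rw [← mul_zero (u1 none), ← h1, mul_sum]
        refine sum_congr rfl fun a _ => ?_
        by_cases ha : a ∈ S
        · simp [hV, hb, hout a ha b hb]
        · simp only [ha, dite_false, hV, hb]
          ring)
    ext a
    cases a with
    | some a =>
      have := congrFun h0 a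
      simpa using this
    | none =>
      obtain ⟨z, hz⟩ := Function.ne_iff.1 hy0
      have hzS : z ∉ S := fun h => hz (hyS z h)
      have := congrFun h0 z
      simpa [hzS, show y z ≠ 0 from hz] using this
  · intro x
    refine ⟨fun h => ?_, fun hz h0 => ?_⟩
    · by_contra! h1
      apply h
      refine sum_eq_zero fun z _ => ?_
      by_cases hz : z ∈ S
      · rw [hyS z hz, zero_mul]
      · rw [h1 z hz, mul_zero]
    · simp only [Option.elim] at h0
      obtain ⟨τ, hτ, h'⟩ := hM.exists_matching_compl hc hS ht x.2 hz
      obtain ⟨σ, hσ, h⟩ := hM.exists_matching_erase hS' x.1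
      refine hy0 (hG (fun a b => if a ∉ S → b ∉ (nb M S).erase x then M a b else 0) ?_ ?_ y ?_)
      · intro a b
        by_cases hab : a ∉ S → b ∉ (nb M S).erase x
        · exact ⟨1, zero_le_one, by simp only [if_pos hab, one_mul]⟩
        · exact ⟨0, le_rfl, by simp only [if_neg hab, zero_mul]⟩
      · refine hasMatching_of_parts _ S ((nb M S).erase x) σ hσ ?_ τ hτ ?_
        · intro a
          refine ⟨(h a).1, ?_⟩
          rw [if_pos (fun h => absurd a.2 h)]
          exact (h a).2
        · intro a
          refine ⟨(h' a).1, ?_⟩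
          rw [if_pos (fun _ => (h' a).1)]
          exact (h' a).2
      · ext b
        simp only [Matrix.vecMul, dotProduct, Pi.zero_apply]
        by_cases hb : b ∈ (nb M S).erase x
        · refine sum_eq_zero fun a _ => ?_
          by_cases ha : a ∈ S
          · rw [hyS a ha, zero_mul]
          · simp [ha, hb, -mem_erase]
        · simp only [hb, not_false_eq_true, implies_true, if_true]
          by_cases hbx : b = x
          · rw [hbx]
            exact h0
          · exact hy b fun h => hb (mem_erase.2 ⟨hbx, h⟩)

/-- Contraction of a row `f` whose only nonzero entries are in columns `p` and `q`: the two
columns are merged so as to eliminate row `f`. -/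
def colContract (M : Matrix ι κ ℝ) (f : ι) (p q : κ) : Matrix {a // a ≠ f} {c // c ≠ q} ℝ :=
  fun a c => if c = p then M f q * M a p - M f p * M a q else M a c

theorem SignNonsingular.colContract {M : Matrix ι κ ℝ} (hG : SignNonsingular M) {f : ι} {p q : κ}
    (hpq : p ≠ q) (hp : M f p ≠ 0) (hq : M f q ≠ 0) (hf : ∀ b, b ≠ p → b ≠ q → M f b = 0) :
    SignNonsingular (colContract M f p q) := by
  rintro V2 hV2 ⟨σ2, hσ2, hm⟩ u2 hu2
  let pp : {c // c ≠ q} := ⟨p, hpq⟩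
  choose l hl hl' using fun a => hV2 a pp
  have hl' : ∀ a, V2 a pp = l a * (M f q * M a p - M f p * M a q) := by
    intro a
    rw [hl' a]
    simp [SignMatrix.colContract, pp]
  set V : Matrix ι κ ℝ := fun a b =>
    if ha : a = f then M f b else if hb : b = p ∨ b = q then l ⟨a, ha⟩ * M a b else
      V2 ⟨a, ha⟩ ⟨b, fun h => hb (Or.inr h)⟩ with hV
  have hdom : Dominated V M := by
    intro a b
    by_cases ha : a = f
    · exact ⟨1, zero_le_one, by simp [hV, ha]⟩
    by_cases hb : b = p ∨ b = q
    · exact ⟨l ⟨a, ha⟩, hl _, by simp [hV, ha, hb]⟩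
    · obtain ⟨c, hc, h⟩ := hV2 ⟨a, ha⟩ ⟨b, fun h => hb (Or.inr h)⟩
      push Not at hb
      exact ⟨c, hc, by simpa [hV, ha, hb, SignMatrix.colContract] using h⟩
  have hVp : ∀ a : {a // a ≠ f}, σ2 a ≠ pp → V a (σ2 a) ≠ 0 := by
    intro a ha
    have h1 : (σ2 a).1 ≠ p := fun h => ha (Subtype.ext h)
    have h2 := (σ2 a).2
    have := hm a
    simp only [hV, a.2, h1, h2, or_false, dite_false]
    exact this
  have hmatch : HasMatching V := by
    by_cases hA : ∃ a0, σ2 a0 = pp ∧ M a0 q = 0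
    · obtain ⟨a0, ha0, h0⟩ := hA
      refine ⟨fun a => if ha : a = f then q else σ2 ⟨a, ha⟩, ?_, ?_⟩
      · intro a a' h
        by_cases ha : a = f <;> by_cases ha' : a' = f <;>
          simp only [ha, ha', dite_true, dite_false] at h ⊢
        · exact absurd h.symm (σ2 _).2
        · exact absurd h (σ2 _).2
        · simpa using hσ2 (Subtype.ext h)
      · intro a
        by_cases ha : a = f
        · simp [hV, ha, hq]
        · simp only [ha, dite_false]
          by_cases hap : σ2 ⟨a, ha⟩ = pp
          · have : (⟨a, ha⟩ : {a // a ≠ f}) = a0 := hσ2 (hap.trans ha0.symm)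
            have h3 := hm ⟨a, ha⟩
            rw [hap, hl'] at h3
            rw [hap]
            simp only [hV, ha, dite_false, pp, true_or, dite_true]
            refine mul_ne_zero (left_ne_zero_of_mul h3) fun h4 => h3 ?_
            rw [← this] at h0
            simp only at h0 h4 ⊢
            rw [h0, h4]
            ring
          · exact hVp ⟨a, ha⟩ hap
    · push Not at hA
      refine ⟨fun a => if ha : a = f then p else if σ2 ⟨a, ha⟩ = pp then q else σ2 ⟨a, ha⟩, ?_, ?_⟩
      · intro a a' h
        by_cases ha : a = f <;> by_cases ha' : a' = f <;>
          simp only [ha, ha', dite_true, dite_false] at h ⊢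
        · split_ifs at h with h1
          · exact absurd h hpq
          · exact absurd (Subtype.ext h.symm) h1
        · split_ifs at h with h1
          · exact absurd h.symm hpq
          · exact absurd (Subtype.ext h) h1
        · split_ifs at h with h1 h2 h2
          · simpa using hσ2 (h1.trans h2.symm)
          · exact absurd h.symm (σ2 _).2
          · exact absurd h (σ2 _).2
          · simpa using hσ2 (Subtype.ext h)
      · intro a
        by_cases ha : a = f
        · simp [hV, ha, hp]
        · simp only [ha, dite_false]
          split_ifs with h1
          · have h3 := hm ⟨a, ha⟩
            rw [h1, hl'] at h3
            simp only [hV, ha, dite_false, or_true, dite_true]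
            exact mul_ne_zero (left_ne_zero_of_mul h3) (hA _ h1)
          · exact hVp ⟨a, ha⟩ h1
  set s : ℝ := ∑ a, u2 a * (l a * M a p) with hs
  have hsplit : ∀ g : ι → ℝ, ∑ a, g a = g f + ∑ a : {a // a ≠ f}, g a := by
    intro g
    exact Fintype.sum_eq_add_sum_subtype_ne g f
  have h0 := hG V hdom hmatch (fun a => if ha : a = f then -s / M f p else u2 ⟨a, ha⟩) (by
    ext b
    simp only [Matrix.vecMul, dotProduct, Pi.zero_apply]
    rw [hsplit]
    have h5 : ∀ a : {a // a ≠ f}, (if ha : a.1 = f then -s / M f p else u2 ⟨a, ha⟩) = u2 a := by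
      intro a
      simp [a.2]
    simp only [dite_true, h5]
    by_cases hbp : b = p
    · subst hbp
      have : ∀ a : {a // a ≠ f}, V a b = l a * M a b := by
        intro a
        simp [hV, a.2]
      simp only [this, ← hs]
      simp only [hV, dite_true]
      field_simp
      ring
    by_cases hbq : b = q
    · subst hbq
      have : ∀ a : {a // a ≠ f}, V a b = l a * M a b := by
        intro a
        simp [hV, a.2]
      simp only [this]
      simp only [hV, dite_true]
      have h6 := congrFun hu2 pp
      simp only [Matrix.vecMul, dotProduct, Pi.zero_apply, hl'] at h6
      have h7 : ∑ a, u2 a * (l a * (M f b * M a p - M f p * M a b)) =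
          M f b * s - M f p * ∑ a, u2 a * (l a * M a b) := by
        rw [hs, mul_sum, mul_sum, ← sum_sub_distrib]
        exact sum_congr rfl fun a _ => by ring
      rw [h6] at h7
      have h8 : -s / M f p * M f b * M f p = -s * M f b := by field_simp
      refine mul_right_cancel₀ hp ?_
      rw [add_mul, h8]
      linarith
    · have h6 := congrFun hu2 ⟨b, hbq⟩
      simp only [Matrix.vecMul, dotProduct, Pi.zero_apply] at h6
      have h7 : V f b = 0 := by simp [hV, hf b hbp hbq]
      rw [h7, mul_zero, zero_add, ← h6]
      refine sum_congr rfl fun a _ => ?_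
      simp [hV, a.2, hbp, hbq])
  ext a
  have := congrFun h0 a
  simpa [a.2] using this

section Contraction

variable {M : Matrix ι κ ℝ} {S : Finset ι} {N : Matrix (Option {a // a ∈ S}) {b // b ∈ nb M S} ℝ}

lemma brace_of_row_contraction (hc : Fintype.card ι = Fintype.card κ) (ht : #(nb M S) = #S + 1)
    (h1 : ∀ R ⊆ S, R.Nonempty → #R + 1 ≤ #S → #R + 2 ≤ #(nb M R))
    (h2 : ∀ R, Sᶜ ⊆ R → #R + 2 ≤ Fintype.card ι → #R + 2 ≤ #(nb M R))
    (hN : ∀ a x, N (some a) x = M a x) (hN' : ∀ x, N none x ≠ 0 ↔ ∃ z ∉ S, M z x ≠ 0) :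
    Brace N := by
  intro R hne hR
  rw [Fintype.card_option, Fintype.card_coe] at hR
  set R0 : Finset ι := (eraseNone R).map (Function.Embedding.subtype _) with hR0
  have hR0S : R0 ⊆ S := by
    intro a ha
    simp only [hR0, mem_map, Function.Embedding.subtype_apply] at ha
    obtain ⟨x, -, rfl⟩ := ha
    exact x.2
  have hmem : ∀ a : {a // a ∈ S}, a.1 ∈ R0 ↔ some a ∈ R := by
    intro a
    simp [hR0]
  have hcard : #R0 = #(eraseNone R) := card_map _
  have hY : #(nb N R) = #((nb N R).map (Function.Embedding.subtype _)) := (card_map _).symm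
  rw [hY]
  by_cases hn : none ∈ R
  · have h3 : #R = #R0 + 1 := by
      rw [hcard, card_eraseNone_of_mem hn]
      have := hne.card_pos
      omega
    have h4 : #(R0 ∪ Sᶜ) = #R0 + #Sᶜ :=
      card_union_of_disjoint (disjoint_compl_right.mono_left hR0S)
    have h5 := card_add_card_compl S
    have h6 := h2 (R0 ∪ Sᶜ) subset_union_right (by omega)
    have h7 : nb M (R0 ∪ Sᶜ) ⊆ (nb N R).map (Function.Embedding.subtype _) ∪ (nb M S)ᶜ := by
      intro b hb
      rw [mem_union, mem_compl, or_iff_not_imp_right, not_not]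
      intro hbS
      rw [mem_nb] at hb
      obtain ⟨a, ha, hab⟩ := hb
      rw [mem_map]
      refine ⟨⟨b, hbS⟩, ?_, rfl⟩
      rw [mem_nb]
      rcases mem_union.1 ha with ha | ha
      · exact ⟨some ⟨a, hR0S ha⟩, (hmem ⟨a, hR0S ha⟩).1 ha, by rw [hN]; exact hab⟩
      · exact ⟨none, hn, (hN' _).2 ⟨a, mem_compl.1 ha, hab⟩⟩
    have h8 := (card_le_card h7).trans (card_union_le _ _)
    have h9 := card_add_card_compl (nb M S)
    omega
  · have h3 : #R = #R0 := by rw [hcard, card_eraseNone_of_not_mem hn]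
    have h4 := h1 R0 hR0S (by rw [← card_pos]; have := hne.card_pos; omega) (by omega)
    rw [h3]
    refine h4.trans (card_le_card ?_)
    intro b hb
    have hbS := nb_mono M hR0S hb
    rw [mem_nb] at hb
    obtain ⟨a, ha, hab⟩ := hb
    rw [mem_map]
    refine ⟨⟨b, hbS⟩, ?_, rfl⟩
    rw [mem_nb]
    exact ⟨some ⟨a, hR0S ha⟩, (hmem ⟨a, hR0S ha⟩).1 ha, by rw [hN]; exact hab⟩

lemma card_low_row_contraction_le (hN : ∀ a x, N (some a) x = M a x) :
    #(low N) ≤ #(low M ∩ S) + 1 := by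
  have h1 : (eraseNone (low N)).map (Function.Embedding.subtype _) ⊆ low M ∩ S := by
    intro a ha
    simp only [mem_map, mem_eraseNone, Function.Embedding.subtype_apply] at ha
    obtain ⟨x, hx, rfl⟩ := ha
    refine mem_inter.2 ⟨?_, x.2⟩
    rw [mem_low] at hx ⊢
    refine le_trans ?_ hx
    rw [← card_map (Function.Embedding.subtype (· ∈ nb M S)) (s := nb N {some x})]
    refine card_le_card ?_
    intro b hb
    rw [mem_nb] at hb
    simp only [mem_singleton, exists_eq_left] at hb
    rw [mem_map]
    exact ⟨⟨b, mem_nb.2 ⟨x, x.2, hb⟩⟩, mem_nb.2 ⟨some x, mem_singleton_self _, by rwa [hN]⟩, rfl⟩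
  have h2 := card_le_card h1
  rw [card_map] at h2
  have h3 : #(low N) ≤ #(eraseNone (low N)) + 1 := by
    by_cases hn : none ∈ low N
    · rw [card_eraseNone_of_mem hn]
      omega
    · rw [card_eraseNone_of_not_mem hn]
      omega
  omega

end Contraction

lemma exists_tight_leaf (hc : Fintype.card ι = Fintype.card κ) {M : Matrix ι κ ℝ}
    (hG : SignNonsingular M) (hM : MatchingCovered M) (b : κ)
    (hb : ∀ R : Finset ι, R.Nonempty → #R + 2 ≤ Fintype.card ι → #(nb M R) ≤ #R + 1 → b ∉ nb M R)
    (hB : ¬ Brace M)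
    (ih : ∀ {α β : Type} [Fintype α] [Fintype β] (N : Matrix α β ℝ),
      Fintype.card α = Fintype.card β → 3 ≤ Fintype.card α → Fintype.card α < Fintype.card ι →
      SignNonsingular N → Brace N → 3 ≤ #(low N)) :
    ∃ S : Finset ι, S.Nonempty ∧ #S + 2 ≤ Fintype.card ι ∧ #(nb M S) = #S + 1 ∧ b ∉ nb M S ∧
      (2 ≤ #(low M ∩ S) ∨ #S = 1) := by
  classical
  unfold Brace at hB
  push Not at hB
  obtain ⟨S0, h01, h02, h03⟩ := hB
  obtain ⟨S, hS, hmin⟩ := exists_min_image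
    (univ.filter fun S : Finset ι => S.Nonempty ∧ #S + 2 ≤ Fintype.card ι ∧ #(nb M S) < #S + 2)
    card ⟨S0, by simp only [mem_filter, mem_univ, true_and]; exact ⟨h01, h02, h03⟩⟩
  simp only [mem_filter, mem_univ, true_and, and_imp] at hS hmin
  obtain ⟨hne, hcard, hnb⟩ := hS
  have hne' : S ≠ univ := by
    rintro rfl
    rw [card_univ] at hcard
    omega
  have ht : #(nb M S) = #S + 1 := by
    have := hM S hne hne'
    omega
  have hbS := hb S hne hcard ht.le
  refine ⟨S, hne, hcard, ht, hbS, ?_⟩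
  by_contra! hcon
  have hpos := hne.card_pos
  obtain ⟨N, hNG, hN, hN'⟩ := hG.exists_row_contraction hc hM hne hne' ht
  have hNB : Brace N := by
    refine brace_of_row_contraction hc ht ?_ ?_ hN hN'
    · intro R hR hRne hRc
      by_contra! h
      have := hmin R hRne (by omega) h
      omega
    · intro R hR hRc
      by_contra! h
      have hRne : R.Nonempty := by
        rw [← card_pos]
        have := card_le_card hR
        rw [card_compl] at this
        omega
      have h1 := hb R hRne hRc (by omega)
      have h2 := hM.nb_univ hc (by omega)
      have h3 : R ∪ S = univ := by
        ext a
        have := @hR a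
        simp only [mem_compl] at this
        simp only [mem_union, mem_univ, iff_true]
        tauto
      rw [← h3, nb_union] at h2
      have := mem_univ b
      rw [← h2, mem_union] at this
      tauto
  have h1 := ih N (by rw [Fintype.card_option, Fintype.card_coe, Fintype.card_coe, ht])
    (by rw [Fintype.card_option, Fintype.card_coe]; omega)
    (by rw [Fintype.card_option, Fintype.card_coe]; omega) hNG hNB
  have h2 := card_low_row_contraction_le hN
  omega

lemma Brace.nb_eq_univ (hc : Fintype.card ι = Fintype.card κ) {M : Matrix ι κ ℝ} (hB : Brace M)
    (h3 : 3 ≤ Fintype.card ι) {R : Finset ι} (hR : Fintype.card ι ≤ #R + 2) : nb M R = univ := by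
  obtain ⟨T, hTR, hT⟩ := exists_subset_card_eq (show Fintype.card ι - 2 ≤ #R by omega)
  have h1 := hB T (by rw [← card_pos]; omega) (by omega)
  have h2 := card_le_card (nb_mono M hTR)
  rw [← card_eq_iff_eq_univ]
  have := card_le_univ (nb M R)
  omega

/-- The matrix `M` with its entry at `(f, b)` replaced by zero. -/
def zeroEntry (M : Matrix ι κ ℝ) (f : ι) (b : κ) : Matrix ι κ ℝ :=
  fun a c => if a = f ∧ c = b then 0 else M a c

lemma zeroEntry_dominated (M : Matrix ι κ ℝ) (f : ι) (b : κ) : Dominated (zeroEntry M f b) M := by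
  intro a c
  by_cases h : a = f ∧ c = b
  · exact ⟨0, le_rfl, by rw [zeroEntry, if_pos h, zero_mul]⟩
  · exact ⟨1, zero_le_one, by rw [zeroEntry, if_neg h, one_mul]⟩

lemma nb_subset_insert_zeroEntry (M : Matrix ι κ ℝ) (f : ι) (b : κ) (R : Finset ι) :
    nb M R ⊆ insert b (nb (zeroEntry M f b) R) := by
  intro c hc
  rw [mem_nb] at hc
  obtain ⟨a, ha, hac⟩ := hc
  rw [mem_insert, or_iff_not_imp_left]
  intro hcb
  exact mem_nb.2 ⟨a, ha, by simpa [zeroEntry, hcb] using hac⟩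

lemma nb_zeroEntry_of_notMem (M : Matrix ι κ ℝ) {f : ι} (b : κ) {R : Finset ι} (hf : f ∉ R) :
    nb (zeroEntry M f b) R = nb M R := by
  ext c
  simp only [mem_nb]
  refine exists_congr fun a => and_congr_right fun ha => ?_
  have : a ≠ f := fun h => hf (h ▸ ha)
  simp [zeroEntry, this]

lemma Brace.matchingCovered_zeroEntry (hc : Fintype.card ι = Fintype.card κ) {M : Matrix ι κ ℝ}
    (hB : Brace M) (h3 : 3 ≤ Fintype.card ι) (f : ι) (b : κ) :
    MatchingCovered (zeroEntry M f b) := by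
  intro R hR hR'
  have hlt := (card_lt_iff_ne_univ R).2 hR'
  have h1 := card_le_card (nb_subset_insert_zeroEntry M f b R)
  by_cases h : #R + 2 ≤ Fintype.card ι
  · have h2 := hB R hR h
    have h4 := card_insert_le b (nb (zeroEntry M f b) R)
    omega
  · have h5 := nb_zeroEntry_of_notMem M b (notMem_erase f R)
    have h6 := hB.nb_eq_univ hc h3 (R := R.erase f) (by
      have := pred_card_le_card_erase (s := R) (a := f)
      omega)
    rw [h6] at h5
    have h7 := card_le_card (nb_mono (zeroEntry M f b) (erase_subset f R))
    rw [h5, card_univ, ← hc] at h7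
    omega

lemma Brace.exists_low (hc : Fintype.card ι = Fintype.card κ) {M : Matrix ι κ ℝ}
    (hB : Brace M) (hG : SignNonsingular M) (h4 : 4 ≤ Fintype.card ι)
    (ih : ∀ {α β : Type} [Fintype α] [Fintype β] (N : Matrix α β ℝ),
      Fintype.card α = Fintype.card β → 3 ≤ Fintype.card α → Fintype.card α < Fintype.card ι →
      SignNonsingular N → Brace N → 3 ≤ #(low N))
    (ih' : ∀ f b, M f b ≠ 0 → Brace (zeroEntry M f b) → 3 ≤ #(low (zeroEntry M f b))) :
    (low M).Nonempty := by
  by_contra hlow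
  rw [not_nonempty_iff_eq_empty] at hlow
  have hdeg : ∀ a, 4 ≤ #(nb M {a}) := by
    intro a
    by_contra! h
    have : a ∈ low M := mem_low.2 (by omega)
    simp [hlow] at this
  have : Nonempty ι := Fintype.card_pos_iff.1 (by omega)
  obtain ⟨f⟩ := this
  obtain ⟨b, hfb⟩ := card_pos.1 (show 0 < #(nb M {f}) by have := hdeg f; omega)
  simp only [mem_nb, mem_singleton, exists_eq_left] at hfb
  have hdeg' : ∀ a, 3 ≤ #(nb (zeroEntry M f b) {a}) := by
    intro a
    have h1 := hdeg a
    have h2 := card_le_card (nb_subset_insert_zeroEntry M f b {a})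
    have h3 := card_insert_le b (nb (zeroEntry M f b) {a})
    omega
  have hlow' : #(low (zeroEntry M f b)) ≤ 1 := by
    refine (card_le_card (t := {f}) ?_).trans (card_singleton f).le
    intro a ha
    rw [mem_singleton]
    by_contra h
    rw [mem_low, nb_zeroEntry_of_notMem M b (by simpa using Ne.symm h)] at ha
    have := hdeg a
    omega
  by_cases hB' : Brace (zeroEntry M f b)
  · have := ih' f b hfb hB'
    omega
  · obtain ⟨S, hS, hSc, ht, hbS, h2 | h2⟩ := exists_tight_leaf hc
      (hG.of_dominated (zeroEntry_dominated M f b))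
      (hB.matchingCovered_zeroEntry hc (by omega) f b) b (by
        intro R hR hRc hnb hbR
        have h5 := nb_subset_insert_zeroEntry M f b R
        rw [insert_eq_of_mem hbR] at h5
        have := card_le_card h5
        have := hB R hR hRc
        omega) hB' ih
    · have := card_le_card (inter_subset_left : low (zeroEntry M f b) ∩ S ⊆ _)
      omega
    · obtain ⟨a, rfl⟩ := card_eq_one.1 h2
      have := hdeg' a
      rw [ht, card_singleton] at this
      omega

lemma mem_nb_singleton {M : Matrix ι κ ℝ} {a : ι} {b : κ} : b ∈ nb M {a} ↔ M a b ≠ 0 := by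
  simp [mem_nb]

section ColContract

variable {M : Matrix ι κ ℝ} {f : ι} {p q : κ}

lemma Brace.colContract_ne_zero (hB : Brace M) (hG : SignNonsingular M) (hpq : p ≠ q)
    (hp : M f p ≠ 0) (hq : M f q ≠ 0) (a : {a // a ≠ f}) (c : {c // c ≠ q}) :
    colContract M f p q a c ≠ 0 ↔ M a c ≠ 0 ∨ (c.1 = p ∧ M a q ≠ 0) := by
  by_cases hc : c.1 = p
  · simp only [colContract, hc, if_true, true_and]
    by_cases hap : M a p = 0 <;> by_cases haq : M a q = 0
    · simp [hap, haq]
    · simp [hap, haq, hp]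
    · simp [hap, haq, hq]
    · have := hG.four_cycle_neg hB (Ne.symm a.2) hpq hp hq hap haq
      refine iff_of_true (fun h0 => ?_) (Or.inl hap)
      rw [sub_eq_zero] at h0
      have h1 : M f p * M f q * (M a p * M a q) = (M f p * M a q) ^ 2 := by
        linear_combination (M f p * M a q) * h0
      rw [h1] at this
      exact absurd this (sq_nonneg _).not_gt
  · simp [colContract, hc]

/-- The set of rows of `M` corresponding to a set of rows other than `f`. -/
def lift (f : ι) (R : Finset {a // a ≠ f}) : Finset ι := R.map (Function.Embedding.subtype _)

lemma mem_lift {R : Finset {a // a ≠ f}} {a : ι} : a ∈ lift f R ↔ ∃ h : a ≠ f, ⟨a, h⟩ ∈ R := by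
  simp [lift]

lemma card_lift (R : Finset {a // a ≠ f}) : #(lift f R) = #R := card_map _

lemma notMem_lift (R : Finset {a // a ≠ f}) : f ∉ lift f R := by
  simp [mem_lift]

variable (hB : Brace M) (hG : SignNonsingular M) (hpq : p ≠ q) (hp : M f p ≠ 0) (hq : M f q ≠ 0)
include hB hG hpq hp hq

lemma Brace.mem_nb_colContract (R : Finset {a // a ≠ f}) (c : {c // c ≠ q}) :
    c ∈ nb (colContract M f p q) R ↔
      c.1 ∈ nb M (lift f R) ∨ (c.1 = p ∧ q ∈ nb M (lift f R)) := by
  simp only [mem_nb, mem_lift, hB.colContract_ne_zero hG hpq hp hq]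
  constructor
  · rintro ⟨a, ha, h | ⟨h, h'⟩⟩
    · exact Or.inl ⟨a, ⟨a.2, ha⟩, h⟩
    · exact Or.inr ⟨h, a, ⟨a.2, ha⟩, h'⟩
  · rintro (⟨a, ⟨h1, h2⟩, h⟩ | ⟨h, a, ⟨h1, h2⟩, h'⟩)
    · exact ⟨⟨a, h1⟩, h2, Or.inl h⟩
    · exact ⟨⟨a, h1⟩, h2, Or.inr ⟨h, h'⟩⟩

lemma Brace.nb_subset_colContract (R : Finset {a // a ≠ f}) :
    nb M (lift f R) ⊆
      insert q ((nb (colContract M f p q) R).map (Function.Embedding.subtype _)) := by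
  intro c hc
  rw [mem_insert, or_iff_not_imp_left]
  intro hcq
  rw [mem_map]
  exact ⟨⟨c, hcq⟩, (hB.mem_nb_colContract hG hpq hp hq R _).2 (Or.inl hc), rfl⟩

lemma Brace.card_nb_le_colContract (R : Finset {a // a ≠ f}) :
    #(nb M (lift f R)) ≤ #(nb (colContract M f p q) R) + 1 := by
  refine (card_le_card (hB.nb_subset_colContract hG hpq hp hq R)).trans ?_
  refine (card_insert_le _ _).trans ?_
  rw [card_map]

lemma Brace.mem_of_card_colContract_lt (R : Finset {a // a ≠ f})
    (h : #(nb (colContract M f p q) R) < #(nb M (lift f R))) :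
    p ∈ nb M (lift f R) ∧ q ∈ nb M (lift f R) := by
  constructor
  · by_contra hpn
    by_cases hqn : q ∈ nb M (lift f R)
    · have h1 : nb M (lift f R) ⊆ insert q
          (((nb (colContract M f p q) R).map (Function.Embedding.subtype _)).erase p) := by
        intro c hc
        have h2 := hB.nb_subset_colContract hG hpq hp hq R hc
        have h3 : c ≠ p := by
          rintro rfl
          exact hpn hc
        rw [mem_insert] at h2 ⊢
        exact h2.imp_right fun h => mem_erase.2 ⟨h3, h⟩
      have h2 := (card_le_card h1).trans (card_insert_le _ _)
      have h3 : p ∈ (nb (colContract M f p q) R).map (Function.Embedding.subtype _) := by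
        rw [mem_map]
        exact ⟨⟨p, hpq⟩, (hB.mem_nb_colContract hG hpq hp hq R _).2 (Or.inr ⟨rfl, hqn⟩), rfl⟩
      have h4 := card_pos.2 ⟨p, h3⟩
      rw [card_erase_of_mem h3, card_map] at h2
      rw [card_map] at h4
      omega
    · have h2 := card_le_card ((subset_insert_iff_of_notMem hqn).1
        (hB.nb_subset_colContract hG hpq hp hq R))
      rw [card_map] at h2
      omega
  · by_contra hqn
    have h2 := card_le_card ((subset_insert_iff_of_notMem hqn).1
      (hB.nb_subset_colContract hG hpq hp hq R))
    rw [card_map] at h2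
    omega

lemma Brace.low_colContract {a : {a // a ≠ f}} (ha : a ∈ low (colContract M f p q)) :
    a.1 ∈ low M ∨ (M a p ≠ 0 ∧ M a q ≠ 0) := by
  have hl : lift f {a} = {a.1} := by simp [lift]
  rw [mem_low] at ha ⊢
  rw [or_iff_not_imp_left]
  intro h
  have := hB.mem_of_card_colContract_lt hG hpq hp hq {a} (by rw [hl]; omega)
  rwa [hl, mem_nb_singleton, mem_nb_singleton] at this

/-- The structure found around a low row `f` of a brace with at most two low rows. -/
theorem Brace.exists_near_tight (hc : Fintype.card ι = Fintype.card κ) (h4 : 4 ≤ Fintype.card ι)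
    (ih : ∀ {α β : Type} [Fintype α] [Fintype β] (N : Matrix α β ℝ),
      Fintype.card α = Fintype.card β → 3 ≤ Fintype.card α → Fintype.card α < Fintype.card ι →
      SignNonsingular N → Brace N → 3 ≤ #(low N))
    (hlow : #(low M) ≤ 2) (hf : f ∈ low M) {b : κ} (hbp : b ≠ p) (hbq : b ≠ q)
    (hnb : nb M {f} = {b, p, q}) :
    ∃ P : Finset ι, f ∉ P ∧ #P + 3 ≤ Fintype.card ι ∧ #(nb M P) ≤ #P + 2 ∧ b ∉ nb M P ∧
      (∃ r ∈ P, M r p ≠ 0 ∧ M r q ≠ 0) ∧ ∃ f' ∈ P, f' ∈ low M := by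
  have hG' : SignNonsingular (colContract M f p q) := by
    have h1 := (hG.of_dominated (zeroEntry_dominated M f b)).colContract hpq (f := f)
      (by simpa [zeroEntry, hbp.symm] using hp) (by simpa [zeroEntry, hbq.symm] using hq) (by
        intro c hcp hcq
        by_cases hcb : c = b
        · simp [zeroEntry, hcb]
        · simp only [zeroEntry, hcb, and_false, if_false]
          by_contra h
          have : c ∈ nb M {f} := mem_nb_singleton.2 h
          simp [hnb, hcb, hcp, hcq] at this)
    convert h1 using 1
    ext a c
    simp [colContract, zeroEntry, hbp.symm, hbq.symm, a.2]
  have hcι : Fintype.card {a // a ≠ f} = Fintype.card ι - 1 := by simp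
  have hcκ : Fintype.card {c // c ≠ q} = Fintype.card κ - 1 := by simp
  have hcc : Fintype.card {a // a ≠ f} = Fintype.card {c // c ≠ q} := by omega
  have hM' : MatchingCovered (colContract M f p q) := by
    intro R hR hR'
    have h1 := (card_lt_iff_ne_univ R).2 hR'
    have h2 := hB (lift f R) (by rw [← card_pos, card_lift]; exact hR.card_pos)
      (by rw [card_lift]; omega)
    rw [card_lift] at h2
    have := hB.card_nb_le_colContract hG hpq hp hq R
    omega
  have hkey : ∀ R : Finset {a // a ≠ f}, R.Nonempty → #R + 2 ≤ Fintype.card {a // a ≠ f} →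
      #(nb (colContract M f p q) R) ≤ #R + 1 → #(nb M (lift f R)) = #R + 2 ∧
        p ∈ nb M (lift f R) ∧ q ∈ nb M (lift f R) ∧ b ∉ nb M (lift f R) := by
    intro R hR hRc hRn
    have h2 := hB (lift f R) (by rw [← card_pos, card_lift]; exact hR.card_pos)
      (by rw [card_lift]; omega)
    rw [card_lift] at h2
    have h3 := hB.card_nb_le_colContract hG hpq hp hq R
    obtain ⟨h5, h6⟩ := hB.mem_of_card_colContract_lt hG hpq hp hq R (by omega)
    refine ⟨by omega, h5, h6, fun h7 => ?_⟩
    have h8 : nb M ({f} ∪ lift f R) = nb M (lift f R) := by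
      rw [nb_union, hnb, union_eq_right]
      intro c hc
      simp only [mem_insert, mem_singleton] at hc
      rcases hc with rfl | rfl | rfl <;> assumption
    have h9 : #({f} ∪ lift f R) = #R + 1 := by
      rw [card_union_of_disjoint (by simpa using notMem_lift R), card_lift, card_singleton]
      omega
    have h10 := hB ({f} ∪ lift f R) ⟨f, by simp⟩ (by omega)
    rw [h8] at h10
    omega
  have hfl : #((low M).erase f) ≤ 1 := by
    rw [card_erase_of_mem hf]
    omega
  have hcom : ∀ a a' : {a // a ≠ f}, M a p ≠ 0 ∧ M a q ≠ 0 → M a' p ≠ 0 ∧ M a' q ≠ 0 → a = a' := by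
    intro a a' ha ha'
    by_contra hne
    exact hG.no_three_common hB (Ne.symm a.2) (Ne.symm a'.2) (fun h => hne (Subtype.ext h)) hpq
      hp hq ha.1 ha.2 ha'.1 ha'.2
  have hlw : ∀ a a' : {a // a ≠ f}, a.1 ∈ low M → a'.1 ∈ low M → a = a' := by
    intro a a' ha ha'
    exact Subtype.ext (card_le_one.1 hfl _ (mem_erase.2 ⟨a.2, ha⟩) _ (mem_erase.2 ⟨a'.2, ha'⟩))
  have hlc : ∀ a ∈ low (colContract M f p q), a.1 ∈ low M ∨ (M a p ≠ 0 ∧ M a q ≠ 0) :=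
    fun a ha => hB.low_colContract hG hpq hp hq ha
  have hnB : ¬ Brace (colContract M f p q) := by
    intro hB'
    have h1 := ih _ hcc (by omega) (by omega) hG' hB'
    obtain ⟨x, hx, y, hy, z, hz, hxy, hxz, hyz⟩ := two_lt_card.1 h1
    rcases hlc x hx with hx' | hx' <;> rcases hlc y hy with hy' | hy' <;>
      rcases hlc z hz with hz' | hz' <;>
      first
      | exact hxy (hlw _ _ hx' hy')
      | exact hxz (hlw _ _ hx' hz')
      | exact hyz (hlw _ _ hy' hz')
      | exact hxy (hcom _ _ hx' hy')
      | exact hxz (hcom _ _ hx' hz')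
      | exact hyz (hcom _ _ hy' hz')
  obtain ⟨S, hS, hSc, ht, -, hS2⟩ := exists_tight_leaf hcc hG' hM' ⟨b, hbq⟩ (by
    intro R hR hRc hRn hbR
    obtain ⟨-, -, -, h⟩ := hkey R hR hRc hRn
    rw [hB.mem_nb_colContract hG hpq hp hq] at hbR
    rcases hbR with hbR | ⟨hbR, -⟩
    · exact h hbR
    · exact hbp hbR) hnB (by
    intro α β _ _ N h1 h2 h3
    exact ih N h1 h2 (by omega))
  obtain ⟨hk1, hk2, hk3, hk4⟩ := hkey S hS hSc ht.le
  refine ⟨lift f S, notMem_lift S, by rw [card_lift]; omega, by rw [card_lift]; omega, hk4, ?_⟩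
  suffices h : (∃ r ∈ S, M r p ≠ 0 ∧ M r q ≠ 0) ∧ ∃ f' ∈ S, f'.1 ∈ low M by
    obtain ⟨⟨r, hr, hr'⟩, f', hf', hf''⟩ := h
    exact ⟨⟨r, mem_lift.2 ⟨r.2, hr⟩, hr'⟩, f', mem_lift.2 ⟨f'.2, hf'⟩, hf''⟩
  rcases hS2 with h2 | h1
  · obtain ⟨x, hx, y, hy, hxy⟩ := one_lt_card.1 h2
    rw [mem_inter] at hx hy
    have hxc := hlc x hx.1
    have hyc := hlc y hy.1
    have h3 := hcom x y
    have h5 := hlw x y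
    by_cases hxl : x.1 ∈ low M
    · by_cases hyl : y.1 ∈ low M
      · exact absurd (h5 hxl hyl) hxy
      · exact ⟨⟨y, hy.2, hyc.resolve_left hyl⟩, x, hx.2, hxl⟩
    · have hx' := hxc.resolve_left hxl
      by_cases hyl : y.1 ∈ low M
      · exact ⟨⟨x, hx.2, hx'⟩, y, hy.2, hyl⟩
      · exact absurd (h3 hx' (hyc.resolve_left hyl)) hxy
  · obtain ⟨a, rfl⟩ := card_eq_one.1 h1
    have hl : lift f {a} = {a.1} := by simp [lift]
    rw [hl, mem_nb_singleton] at hk2 hk3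
    rw [hl, card_singleton] at hk1
    exact ⟨⟨a, mem_singleton_self a, hk2, hk3⟩, a, mem_singleton_self a, mem_low.2 hk1.le⟩

end ColContract

theorem three_le_card_low_of_brace (n : ℕ) : ∀ {ι κ : Type} [Fintype ι] [Fintype κ] (M : Matrix ι κ ℝ),
    Fintype.card ι = n → Fintype.card ι = Fintype.card κ → 3 ≤ Fintype.card ι →
    SignNonsingular M → Brace M → 3 ≤ #(low M) := by
  classical
  induction n using Nat.strong_induction_on with
  | _ n ihn =>
  suffices h : ∀ e : ℕ, ∀ {ι κ : Type} [Fintype ι] [Fintype κ] (M : Matrix ι κ ℝ),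
      #(univ.filter fun x : ι × κ => M x.1 x.2 ≠ 0) = e →
      Fintype.card ι = n → Fintype.card ι = Fintype.card κ → 3 ≤ Fintype.card ι →
      SignNonsingular M → Brace M → 3 ≤ #(low M) from
    fun {ι κ} _ _ M => h _ M rfl
  intro e
  induction e using Nat.strong_induction_on with
  | _ e ihe =>
  intro ι κ _ _ M he hn hc h3 hG hB
  have ih : ∀ {α β : Type} [Fintype α] [Fintype β] (N : Matrix α β ℝ),
      Fintype.card α = Fintype.card β → 3 ≤ Fintype.card α → Fintype.card α < Fintype.card ι →
      SignNonsingular N → Brace N → 3 ≤ #(low N) :=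
    fun N h1 h2 h5 => ihn _ (by omega) N rfl h1 h2
  by_contra! hlow
  by_cases h4 : Fintype.card ι = 3
  · have : low M = univ := by
      ext a
      simp only [mem_univ, iff_true, mem_low]
      exact (card_le_univ _).trans (by omega)
    rw [this, card_univ] at hlow
    omega
  obtain ⟨f, hf⟩ := hB.exists_low hc hG (by omega) ih (by
    intro f b hfb hB'
    refine ihe _ ?_ (zeroEntry M f b) rfl hn hc h3 (hG.of_dominated (zeroEntry_dominated M f b)) hB'
    rw [← he]
    refine card_lt_card ((ssubset_iff_of_subset ?_).2 ⟨(f, b), by simpa using hfb, by simp [zeroEntry]⟩)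
    intro x hx
    rw [mem_filter] at hx ⊢
    exact ⟨mem_univ x, fun h => hx.2 (by simp [zeroEntry, h])⟩)
  have hfnb : #(nb M {f}) = 3 := by
    have h1 := mem_low.1 hf
    have h2 := hB {f} (singleton_nonempty f) (by rw [card_singleton]; omega)
    rw [card_singleton] at h2
    omega
  obtain ⟨x, y, z, hxy, hxz, hyz, hnb⟩ := card_eq_three.1 hfnb
  have hx : M f x ≠ 0 := mem_nb_singleton.1 (by rw [hnb]; simp)
  have hy : M f y ≠ 0 := mem_nb_singleton.1 (by rw [hnb]; simp)
  have hz : M f z ≠ 0 := mem_nb_singleton.1 (by rw [hnb]; simp)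
  obtain ⟨P, hfP, hPc, hPn, hxP, ⟨r, hrP, hry, hrz⟩, f1, hf1, hf1l⟩ :=
    hB.exists_near_tight hG hyz hy hz hc (by omega) ih (by omega) hf hxy hxz hnb
  obtain ⟨Q, hfQ, hQc, hQn, hyQ, ⟨s, hsQ, hsx, hsz⟩, f2, hf2, hf2l⟩ :=
    hB.exists_near_tight hG hxz hx hz hc (by omega) ih (by omega) hf hxy.symm hyz
      (by rw [hnb]; ext; simp only [mem_insert, mem_singleton]; tauto)
  obtain ⟨W, hfW, hWc, hWn, hzW, ⟨t, htW, htx, hty⟩, f3, hf3, hf3l⟩ :=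
    hB.exists_near_tight hG hxy hx hy hc (by omega) ih (by omega) hf hxz.symm hyz.symm
      (by rw [hnb]; ext; simp only [mem_insert, mem_singleton]; tauto)
  have huniq : ∀ a a', a ∈ low M → a' ∈ low M → a ≠ f → a' ≠ f → a = a' := by
    intro a a' ha ha' haf haf'
    have : #((low M).erase f) ≤ 1 := by
      rw [card_erase_of_mem hf]
      omega
    exact card_le_one.1 this _ (mem_erase.2 ⟨haf, ha⟩) _ (mem_erase.2 ⟨haf', ha'⟩)
  have hne : ∀ {A : Finset ι} {a : ι}, a ∈ A → f ∉ A → a ≠ f := fun ha hfA h => hfA (h ▸ ha)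
  obtain rfl := huniq f2 f1 hf2l hf1l (hne hf2 hfQ) (hne hf1 hfP)
  obtain rfl := huniq f3 f2 hf3l hf2l (hne hf3 hfW) (hne hf2 hfQ)
  have hnot : ∀ {A : Finset ι} {a : ι} {c : κ}, c ∉ nb M A → M a c ≠ 0 → a ∉ A :=
    fun hcA hac ha => hcA (mem_nb.2 ⟨_, ha, hac⟩)
  have hPQ : #(P ∪ Q) + 2 ≤ Fintype.card ι := by
    have h1 : P ∪ Q ⊆ {f, t}ᶜ := by
      intro a ha
      simp only [mem_compl, mem_insert, mem_singleton, not_or]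
      have := hnot hxP htx
      have := hnot hyQ hty
      constructor <;> rintro rfl <;> rw [mem_union] at ha <;> tauto
    have h2 := card_le_card h1
    rw [card_compl, card_pair (hne htW hfW).symm] at h2
    omega
  have h1 := hB (P ∪ Q) ⟨f3, mem_union_left _ hf1⟩ hPQ
  have h2 := card_union_add_card_inter P Q
  have h5 := card_union_add_card_inter (nb M P) (nb M Q)
  rw [← nb_union] at h5
  have hfPQ : f3 ∈ P ∩ Q := mem_inter.2 ⟨hf1, hf2⟩
  have h6 := hB (P ∩ Q) ⟨f3, hfPQ⟩ (by
    have := card_le_card (inter_subset_left : P ∩ Q ⊆ P)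
    omega)
  have h7 : nb M (P ∩ Q) = nb M P ∩ nb M Q :=
    eq_of_subset_of_card_le (nb_inter_subset M P Q) (by omega)
  have hzPQ : z ∈ nb M (P ∩ Q) := by
    rw [h7, mem_inter]
    exact ⟨mem_nb.2 ⟨r, hrP, hrz⟩, mem_nb.2 ⟨s, hsQ, hsz⟩⟩
  have hfU : f ∉ (P ∩ Q) ∪ W := by
    simp [hfP, hfW]
  have hU : #((P ∩ Q) ∪ W) + 3 ≤ Fintype.card ι := by
    have h8 : (P ∩ Q) ∪ W ⊆ {f, r, s}ᶜ := by
      intro a ha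
      simp only [mem_compl, mem_insert, mem_singleton, not_or]
      have := hnot hyQ hry
      have := hnot hzW hrz
      have := hnot hxP hsx
      have := hnot hzW hsz
      refine ⟨?_, ?_, ?_⟩ <;> rintro rfl <;> rw [mem_union, mem_inter] at ha <;> tauto
    have h9 := card_le_card h8
    have hrs : r ≠ s := by
      rintro rfl
      exact hnot hyQ hry hsQ
    have h10 : #({f, r, s} : Finset ι) = 3 :=
      card_eq_three.2 ⟨f, r, s, (hne hrP hfP).symm, (hne hsQ hfQ).symm, hrs, rfl⟩
    have h11 := card_le_univ ({f, r, s} : Finset ι)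
    rw [card_compl, h10] at h9
    omega
  have hsub : {x, y, z} ⊆ nb M ((P ∩ Q) ∪ W) := by
    intro c hc
    rw [nb_union, mem_union]
    simp only [mem_insert, mem_singleton] at hc
    rcases hc with rfl | rfl | rfl
    · exact Or.inr (mem_nb.2 ⟨t, htW, htx⟩)
    · exact Or.inr (mem_nb.2 ⟨t, htW, hty⟩)
    · exact Or.inl hzPQ
  have h8 := hB ({f} ∪ ((P ∩ Q) ∪ W)) ⟨f, by simp⟩ (by
    have := card_union_le {f} ((P ∩ Q) ∪ W)
    rw [card_singleton] at this
    omega)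
  rw [card_union_of_disjoint (by simpa using hfU), card_singleton, nb_union M {f}, hnb,
    union_eq_right.2 hsub, nb_union] at h8
  have h9 := card_union_add_card_inter (nb M (P ∩ Q)) (nb M W)
  have h10 := card_union_add_card_inter (P ∩ Q) W
  have h11 := hB ((P ∩ Q) ∩ W) ⟨f3, mem_inter.2 ⟨hfPQ, hf3⟩⟩ (by
    have := card_le_card (inter_subset_right : (P ∩ Q) ∩ W ⊆ W)
    omega)
  have h12 := card_le_card (nb_inter_subset M (P ∩ Q) W)
  rw [h7] at h8 h9 h12
  omega

lemma card_nb_transpose_compl_le (M : Matrix ι κ ℝ) (R : Finset ι) :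
    #(nb M.transpose (nb M R)ᶜ) ≤ #Rᶜ := by
  refine card_le_card fun a ha => ?_
  rw [mem_nb] at ha
  obtain ⟨b, hb, hab⟩ := ha
  rw [mem_compl] at hb ⊢
  exact fun haR => hb (mem_nb.2 ⟨a, haR, hab⟩)

lemma MatchingCovered.transpose (hc : Fintype.card ι = Fintype.card κ) {M : Matrix ι κ ℝ}
    (hM : MatchingCovered M) (h2 : 2 ≤ Fintype.card ι) : MatchingCovered M.transpose := by
  intro T hT hT'
  by_contra! h
  have hlt := (card_lt_iff_ne_univ T).2 hT'
  have h1 := card_nb_transpose_compl_le M.transpose T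
  rw [Matrix.transpose_transpose] at h1
  have h3 := card_add_card_compl (nb M.transpose T)
  have h4 := card_add_card_compl T
  have hpos := hT.card_pos
  by_cases hu : (nb M.transpose T)ᶜ = univ
  · rw [hu, hM.nb_univ hc h2, card_univ] at h1
    omega
  · have := hM _ (by rw [← card_pos]; omega) hu
    omega

lemma SignNonsingular.false_of_min_tight (hc : Fintype.card ι = Fintype.card κ)
    {M : Matrix ι κ ℝ} (hG : SignNonsingular M) (hM : MatchingCovered M)
    (hd : ∀ a, 4 ≤ #(nb M {a})) {S : Finset ι} (hS : S.Nonempty) (hSc : #S + 2 ≤ Fintype.card ι)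
    (hSn : #(nb M S) < #S + 2)
    (hmin : ∀ R : Finset ι, R.Nonempty → #R + 2 ≤ Fintype.card ι → #(nb M R) < #R + 2 → #S ≤ #R)
    (hmin' : ∀ T : Finset κ, T.Nonempty → #T + 2 ≤ Fintype.card κ →
      #(nb M.transpose T) < #T + 2 → #S ≤ #T) : False := by
  have hS' : S ≠ univ := by
    rintro rfl
    rw [card_univ] at hSc
    omega
  have ht : #(nb M S) = #S + 1 := by
    have := hM S hS hS'
    omega
  obtain ⟨N, hNG, hN, hN'⟩ := hG.exists_row_contraction hc hM hS hS' ht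
  have hNB : Brace N := by
    refine brace_of_row_contraction hc ht ?_ ?_ hN hN'
    · intro R hR hRne hRc
      by_contra! h
      have := hmin R hRne (by omega) h
      omega
    · intro R hR hRc
      by_contra! h
      have h1 := card_le_card hR
      have h2 := card_add_card_compl S
      have h3 := card_add_card_compl R
      have h4 := card_add_card_compl (nb M R)
      have h5 := card_nb_transpose_compl_le M R
      have h6 := hM R (by rw [← card_pos]; omega) (by
        rintro rfl
        rw [card_univ] at hRc
        omega)
      have := hmin' (nb M R)ᶜ (by rw [← card_pos]; omega) (by omega) (by omega)
      omega
  obtain ⟨a, ha⟩ := hS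
  have h4 := hd a
  have h5 := card_le_card (nb_mono M (singleton_subset_iff.2 ha))
  have hcard : Fintype.card (Option {a // a ∈ S}) = #S + 1 := by
    rw [Fintype.card_option, Fintype.card_coe]
  have h1 := three_le_card_low_of_brace _ N rfl (by rw [hcard, Fintype.card_coe, ht])
    (by omega) hNG hNB
  have h2 := card_low_row_contraction_le hN
  have h3 : low M ∩ S = ∅ := by
    refine eq_empty_of_forall_notMem fun x hx => ?_
    have := mem_low.1 (mem_inter.1 hx).1
    have := hd x
    omega
  rw [h3, card_empty] at h2
  omega

/-- A matching covered matrix with at least four nonzero entries in every row and column is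
not sign-nonsingular. -/
theorem MatchingCovered.not_signNonsingular [Nonempty ι] (hc : Fintype.card ι = Fintype.card κ)
    {M : Matrix ι κ ℝ} (hM : MatchingCovered M) (hd : ∀ a, 4 ≤ #(nb M {a}))
    (hd' : ∀ b, 4 ≤ #(nb M.transpose {b})) : ¬ SignNonsingular M := by
  intro hG
  have h4 : 4 ≤ Fintype.card ι := by
    rw [hc]
    exact (hd (Classical.arbitrary ι)).trans (card_le_univ _)
  have hB : ¬ Brace M := by
    intro hB
    obtain ⟨a, ha⟩ := card_pos.1 (lt_of_lt_of_le (by norm_num)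
      (three_le_card_low_of_brace _ M rfl hc (by omega) hG hB))
    have := hd a
    have := mem_low.1 ha
    omega
  unfold Brace at hB
  push Not at hB
  obtain ⟨S0, h01, h02, h03⟩ := hB
  obtain ⟨S, hS, hmin⟩ := exists_min_image
    (univ.filter fun S : Finset ι => S.Nonempty ∧ #S + 2 ≤ Fintype.card ι ∧ #(nb M S) < #S + 2)
    card ⟨S0, by simp only [mem_filter, mem_univ, true_and]; exact ⟨h01, h02, h03⟩⟩
  simp only [mem_filter, mem_univ, true_and, and_imp] at hS hmin
  by_cases hT : ∃ T : Finset κ, T.Nonempty ∧ #T + 2 ≤ Fintype.card κ ∧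
      #(nb M.transpose T) < #T + 2 ∧ #T < #S
  · obtain ⟨T0, h11, h12, h13, h14⟩ := hT
    obtain ⟨T, hT, hminT⟩ := exists_min_image
      (univ.filter fun T : Finset κ =>
        T.Nonempty ∧ #T + 2 ≤ Fintype.card κ ∧ #(nb M.transpose T) < #T + 2)
      card ⟨T0, by simp only [mem_filter, mem_univ, true_and]; exact ⟨h11, h12, h13⟩⟩
    simp only [mem_filter, mem_univ, true_and, and_imp] at hT hminT
    have hT0 := hminT T0 h11 h12 h13
    exact (hG.transpose hc).false_of_min_tight hc.symm (hM.transpose hc (by omega)) hd' hT.1 hT.2.1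
      hT.2.2 hminT (fun R h1 h2 h3 => by
        have := hmin R h1 h2 h3
        omega)
  · push Not at hT
    exact hG.false_of_min_tight hc hM hd hS.1 hS.2.1 hS.2.2 hmin hT

/-- A null vector of a nonnegative matrix gives a partial two-coloring of the columns. -/
lemma exists_partial_coloring (hc : Fintype.card ι = Fintype.card κ) {M : Matrix ι κ ℝ}
    (hpos : ∀ a b, 0 ≤ M a b) (hM : ¬ SignNonsingular M) :
    ∃ σ : ι → κ, Function.Bijective σ ∧ (∀ a, M a (σ a) ≠ 0) ∧ ∃ y : κ → SignType, y ≠ 0 ∧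
      ∀ a, y (σ a) = 0 ∨ ∀ s : SignType, s ≠ 0 → ∃ b, M a b ≠ 0 ∧ y b = s := by
  unfold SignNonsingular at hM
  push Not at hM
  obtain ⟨V, hV, ⟨σ, hσ, hm⟩, u, hu, hu0⟩ := hM
  obtain ⟨x, hx, hx0⟩ : ∃ x : κ → ℝ, V.mulVec x = 0 ∧ x ≠ 0 := by
    by_contra! h
    refine hu0 (mulVec_injective_of_vecMul hc.symm V.transpose (fun x hx => ?_) u ?_)
    · exact h x (by rwa [Matrix.vecMul_transpose] at hx)
    · rwa [Matrix.mulVec_transpose]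
  have hVpos : ∀ a b, 0 ≤ V a b := by
    intro a b
    obtain ⟨l, hl, h⟩ := hV a b
    rw [h]
    exact mul_nonneg hl (hpos a b)
  have hVM : ∀ a b, V a b ≠ 0 → M a b ≠ 0 := by
    intro a b h h0
    obtain ⟨l, hl, h'⟩ := hV a b
    exact h (by rw [h', h0, mul_zero])
  have hrow : ∀ (w : κ → ℝ), V.mulVec w = 0 → ∀ a, w (σ a) ≠ 0 → ∃ b, M a b ≠ 0 ∧ 0 < w b := by
    intro w hw a ha
    by_contra! h
    have h1 := congrFun hw a
    simp only [Matrix.mulVec, dotProduct, Pi.zero_apply] at h1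
    have h2 : ∀ b ∈ univ, V a b * w b ≤ 0 := by
      intro b _
      by_cases hb : V a b = 0
      · rw [hb, zero_mul]
      · exact mul_nonpos_of_nonneg_of_nonpos (hVpos a b) (h b (hVM a b hb))
    exact mul_ne_zero (hm a) ha ((sum_eq_zero_iff_of_nonpos h2).1 h1 (σ a) (mem_univ _))
  refine ⟨σ, (Fintype.bijective_iff_injective_and_card σ).2 ⟨hσ, hc⟩, fun a => hVM _ _ (hm a),
    fun b => SignType.sign (x b), ?_, ?_⟩
  · intro h
    apply hx0
    ext b
    have := congrFun h b
    simpa using this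
  · intro a
    by_cases ha : x (σ a) = 0
    · left
      simp [ha]
    · right
      intro s hs
      rcases s.trichotomy with rfl | rfl | rfl
      · obtain ⟨b, hb, hxb⟩ := hrow (-x) (by rw [Matrix.mulVec_neg, hx, neg_zero]) a (by simpa using ha)
        exact ⟨b, hb, sign_neg (by simpa using hxb)⟩
      · exact absurd rfl hs
      · obtain ⟨b, hb, hxb⟩ := hrow x hx a ha
        exact ⟨b, hb, sign_pos hxb⟩

/-- If a nonnegative matching covered matrix is not sign-nonsingular, its columns can be
two-colored with no row monochromatic. -/
theorem MatchingCovered.exists_coloring (hc : Fintype.card ι = Fintype.card κ) {M : Matrix ι κ ℝ}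
    (hM : MatchingCovered M) (hpos : ∀ a b, 0 ≤ M a b) (hG : ¬ SignNonsingular M) :
    ∃ x : κ → Bool, ∀ a c, ∃ b, M a b ≠ 0 ∧ x b = c := by
  obtain ⟨σ, hσ, hm, y0, hy00, hy0⟩ := exists_partial_coloring hc hpos hG
  classical
  obtain ⟨y, hy, hmax⟩ := exists_max_image
    (univ.filter fun y : κ → SignType => y ≠ 0 ∧
      ∀ a, y (σ a) = 0 ∨ ∀ s : SignType, s ≠ 0 → ∃ b, M a b ≠ 0 ∧ y b = s)
    (fun y => #(univ.filter fun b => y b ≠ 0))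
    ⟨y0, by simp only [mem_filter, mem_univ, true_and]; exact ⟨hy00, hy0⟩⟩
  simp only [mem_filter, mem_univ, true_and] at hy hmax
  obtain ⟨hyne, hya⟩ := hy
  have hext : ∀ a, y (σ a) = 0 → ∀ t : SignType, t ≠ 0 →
      ¬ ∀ s : SignType, s ≠ 0 → ∃ b, M a b ≠ 0 ∧ Function.update y (σ a) t b = s := by
    intro a ha t ht hcon
    have h1 : ∀ b, y b ≠ 0 → Function.update y (σ a) t b = y b := by
      intro b hb
      rw [Function.update_of_ne]
      rintro rfl
      exact hb ha
    have h2 := hmax (Function.update y (σ a) t) ⟨fun h => ht (by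
      have := congrFun h (σ a)
      simpa using this), fun a' => by
        by_cases haa : a' = a
        · rw [haa]
          exact Or.inr hcon
        · refine (hya a').imp (fun h => ?_) fun h s hs => ?_
          · rwa [Function.update_of_ne (hσ.1.ne haa)]
          · obtain ⟨b, hb, rfl⟩ := h s hs
            exact ⟨b, hb, h1 b hs⟩⟩
    refine absurd h2 (not_le.2 (card_lt_card ((ssubset_iff_of_subset ?_).2
      ⟨σ a, by simpa using ht, by simpa using ha⟩)))
    intro b hb
    simp only [mem_filter, mem_univ, true_and] at hb ⊢
    rwa [h1 b hb]
  have hbal : ∀ a, (∀ s : SignType, s ≠ 0 → ∃ b, M a b ≠ 0 ∧ y b = s) → y (σ a) ≠ 0 := by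
    intro a h ha
    refine hext a ha 1 (by decide) fun s hs => ?_
    obtain ⟨b, hb, rfl⟩ := h s hs
    refine ⟨b, hb, Function.update_of_ne ?_ _ _⟩
    rintro rfl
    exact hs ha
  have hunb : ∀ a, y (σ a) = 0 → ∀ b, M a b ≠ 0 → y b = 0 := by
    intro a ha b hab
    by_contra hb
    refine hext a ha (-y b) (by simpa using hb) fun s hs => ?_
    by_cases hsb : s = y b
    · refine ⟨b, hab, ?_⟩
      rw [hsb]
      refine Function.update_of_ne ?_ _ _
      rintro rfl
      exact hb ha
    · refine ⟨σ a, hm a, ?_⟩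
      rw [Function.update_self]
      generalize y b = t at *
      revert s t
      decide
  have hall : ∀ a, y (σ a) ≠ 0 := by
    by_contra! h
    obtain ⟨a0, ha0⟩ := h
    set U : Finset ι := univ.filter fun a => y (σ a) = 0 with hU
    have hsub : nb M U ⊆ U.image σ := by
      intro b hb
      rw [mem_nb] at hb
      obtain ⟨a, ha, hab⟩ := hb
      obtain ⟨a', rfl⟩ := hσ.2 b
      exact mem_image_of_mem σ (mem_filter.2 ⟨mem_univ _, hunb a (mem_filter.1 ha).2 _ hab⟩)
    have h1 := (card_le_card hsub).trans card_image_le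
    have h2 : U ≠ univ := by
      intro h
      apply hyne
      ext b
      obtain ⟨a, rfl⟩ := hσ.2 b
      have : a ∈ U := h ▸ mem_univ a
      rw [(mem_filter.1 this).2, Pi.zero_apply]
    have := hM U ⟨a0, mem_filter.2 ⟨mem_univ _, ha0⟩⟩ h2
    omega
  refine ⟨fun b => decide (y b = 1), fun a c => ?_⟩
  have h := (hya a).resolve_left (hall a)
  cases c with
  | true =>
    obtain ⟨b, hb, hyb⟩ := h 1 (by decide)
    exact ⟨b, hb, by simp [hyb]⟩
  | false =>
    obtain ⟨b, hb, hyb⟩ := h (-1) (by decide)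
    exact ⟨b, hb, by simp only [hyb]; decide⟩

lemma card_filter_subtype_of_imp {B : Type} [Fintype B] (p q : B → Prop) [DecidablePred p]
    [Fintype {b // q b}] [DecidablePred fun b : {b // q b} => p b] (h : ∀ b, p b → q b) :
    #(univ.filter fun b : {b // q b} => p b) = #(univ.filter p) := by
  rw [← card_map (Function.Embedding.subtype q)]
  congr 1
  ext b
  simp only [mem_map, mem_filter, mem_univ, true_and, Function.Embedding.subtype_apply,
    Subtype.exists, exists_and_left, exists_prop, exists_eq_right_right]
  exact ⟨fun h => h.1, fun hb => ⟨hb, h b hb⟩⟩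

open Classical in
/-- In a `k`-regular bipartite relation with `k ≥ 4`, one side can be two-colored so that every
vertex of the other side sees both colors. -/
theorem exists_two_coloring_of_regular {k : ℕ} (hk : 4 ≤ k) (n : ℕ) :
    ∀ {A B : Type} [Fintype A] [Fintype B] (r : A → B → Prop), Fintype.card A = n →
      (∀ a, #(univ.filter (r a)) = k) → (∀ b, #(univ.filter fun a => r a b) = k) →
      ∃ x : B → Bool, ∀ a c, ∃ b, r a b ∧ x b = c := by
  induction n using Nat.strong_induction_on with
  | _ n ih =>
  intro A B _ _ r hn hA hB
  rcases isEmpty_or_nonempty A with hemp | hne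
  · exact ⟨fun _ => true, fun a => isEmptyElim a⟩
  have hcount : ∀ (S : Finset A) (T : Finset B),
      ∑ a ∈ S, #(T.filter (r a)) = ∑ b ∈ T, #(S.filter fun a => r a b) :=
    fun S T => sum_card_bipartiteAbove_eq_sum_card_bipartiteBelow r
  have hc : Fintype.card A = Fintype.card B := by
    have h := hcount univ univ
    simp only [hA, hB, sum_const, smul_eq_mul, card_univ] at h
    exact Nat.eq_of_mul_eq_mul_right (by omega) h
  set M : Matrix A B ℝ := fun a b => if r a b then 1 else 0 with hM
  have hMr : ∀ a b, M a b ≠ 0 ↔ r a b := by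
    intro a b
    simp [hM]
  by_cases hMC : MatchingCovered M
  · have hS : ¬ SignNonsingular M := by
      refine hMC.not_signNonsingular hc (fun a => ?_) fun b => ?_
      · refine (hk.trans (hA a).ge).trans (card_le_card fun b hb => ?_)
        rw [mem_nb_singleton, hMr]
        exact (mem_filter.1 hb).2
      · refine (hk.trans (hB b).ge).trans (card_le_card fun a ha => ?_)
        rw [mem_nb_singleton, Matrix.transpose_apply, hMr]
        exact (mem_filter.1 ha).2
    obtain ⟨x, hx⟩ := hMC.exists_coloring hc (fun a b => by simp only [hM]; split_ifs <;> norm_num) hS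
    exact ⟨x, fun a c => (hx a c).imp fun b hb => ⟨(hMr a b).1 hb.1, hb.2⟩⟩
  · unfold MatchingCovered at hMC
    push Not at hMC
    obtain ⟨S, hS, hS', hSn⟩ := hMC
    have hto : ∀ a b, r a b → a ∈ S → b ∈ nb M S :=
      fun a b hab ha => mem_nb.2 ⟨a, ha, (hMr a b).2 hab⟩
    have hcl : ∀ a b, r a b → (a ∈ S ↔ b ∈ nb M S) := by
      intro a b hab
      refine ⟨hto a b hab, fun hb => ?_⟩
      by_contra ha
      have h1 := hcount S (nb M S)
      have h2 : ∑ a ∈ S, #((nb M S).filter (r a)) = #S * k := by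
        rw [← smul_eq_mul, ← sum_const]
        refine sum_congr rfl fun a ha => ?_
        rw [← hA a]
        congr 1
        ext b
        simp only [mem_filter, mem_univ, true_and, and_iff_right_iff_imp]
        exact fun h => hto a b h ha
      have h3 : ∑ b ∈ nb M S, #(S.filter fun a => r a b) < #(nb M S) * k := by
        rw [← smul_eq_mul, ← sum_const]
        refine sum_lt_sum (fun b _ => ?_) ⟨b, hb, ?_⟩
        · rw [← hB b]
          exact card_le_card (filter_subset_filter _ (subset_univ S))
        · rw [← hB b]
          refine card_lt_card ((ssubset_iff_of_subset
            (filter_subset_filter _ (subset_univ S))).2 ⟨a, ?_, ?_⟩)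
          · simpa using hab
          · simp [ha]
      rw [← h1, h2] at h3
      have := Nat.lt_of_mul_lt_mul_right h3
      omega
    have hcS : Fintype.card {a // a ∈ S} < n := by
      rw [Fintype.card_coe, ← hn]
      exact (card_lt_iff_ne_univ S).2 hS'
    have hcS' : Fintype.card {a // a ∉ S} < n := by
      rw [← hn]
      obtain ⟨a, ha⟩ := hS
      exact Fintype.card_subtype_lt (x := a) (by simpa using ha)
    obtain ⟨x, hx⟩ := ih _ hcS (fun (a : {a // a ∈ S}) (b : {b // b ∈ nb M S}) => r a b) rfl
      (fun a => by
        rw [← hA a]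
        exact card_filter_subtype_of_imp (r a) (· ∈ nb M S) fun b hb => (hcl a b hb).1 a.2)
      (fun b => by
        rw [← hB b]
        exact card_filter_subtype_of_imp (fun a => r a b) (· ∈ S) fun a ha => (hcl a b ha).2 b.2)
    obtain ⟨y, hy⟩ := ih _ hcS' (fun (a : {a // a ∉ S}) (b : {b // b ∉ nb M S}) => r a b) rfl
      (fun a => by
        rw [← hA a]
        exact card_filter_subtype_of_imp (r a) (· ∉ nb M S) fun b hb h => a.2 ((hcl a b hb).2 h))
      (fun b => by
        rw [← hB b]
        exact card_filter_subtype_of_imp (fun a => r a b) (· ∉ S) fun a ha h => b.2 ((hcl a b ha).1 h))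
    refine ⟨fun b => if hb : b ∈ nb M S then x ⟨b, hb⟩ else y ⟨b, hb⟩, fun a c => ?_⟩
    by_cases ha : a ∈ S
    · obtain ⟨b, hb, hbc⟩ := hx ⟨a, ha⟩ c
      exact ⟨b, hb, by simp [b.2, hbc]⟩
    · obtain ⟨b, hb, hbc⟩ := hy ⟨a, ha⟩ c
      exact ⟨b, hb, by simp [b.2, hbc]⟩

theorem exists_two_labeling_of_regular_of_colorable_two
    {V : Type} [Fintype V] [DecidableEq V]
    (G : SimpleGraph V) [DecidableRel G.Adj] (k : ℕ) (hk : 4 ≤ k)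
    (hreg : G.IsRegularOfDegree k) (hbip : G.Colorable 2) :
    ∃ c : Sym2 V → Fin 2, ∀ u v : V, G.Adj u v →
      (G.incidenceFinset u).image c ≠ (G.incidenceFinset v).image c := by
  classical
  obtain ⟨C⟩ := hbip
  have hdeg : ∀ v, #(univ.filter (G.Adj v)) = k := by
    intro v
    rw [← hreg v, ← G.card_neighborFinset_eq_degree v, G.neighborFinset_eq_filter]
  have hC : ∀ u v, G.Adj u v → (C u = 0 ↔ C v ≠ 0) := by
    intro u v h
    have := C.valid h
    omega
  obtain ⟨x, hx⟩ := exists_two_coloring_of_regular hk _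
    (fun (a : {v // C v = 0}) (b : {v // C v ≠ 0}) => G.Adj a b) rfl
    (fun a => by
      rw [← hdeg a]
      convert card_filter_subtype_of_imp (G.Adj a) (C · ≠ 0) fun b hb => (hC a b hb).1 a.2)
    (fun b => by
      rw [← hdeg b]
      simp only [G.adj_comm b]
      convert card_filter_subtype_of_imp (fun a => G.Adj a b) (C · = 0) fun a ha => (hC a b ha).2 b.2)
  set c : Sym2 V → Fin 2 := fun e => if ∃ b : {v // C v ≠ 0}, b.1 ∈ e ∧ x b = true then 1 else 0
    with hc
  have hcx : ∀ (a : V) (b : {v // C v ≠ 0}), G.Adj a b → c s(a, b) = if x b then 1 else 0 := by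
    intro a b hab
    have ha := (hC a b hab).2 b.2
    simp only [hc]
    congr 1
    simp only [Sym2.mem_iff, eq_iff_iff]
    constructor
    · rintro ⟨b', h | h, h'⟩
      · exact absurd (h ▸ ha) b'.2
      · rwa [← Subtype.ext h]
    · exact fun h => ⟨b, Or.inr rfl, h⟩
  have key : ∀ u v : V, G.Adj u v → C u = 0 →
      (G.incidenceFinset u).image c ≠ (G.incidenceFinset v).image c := by
    intro u v huv hu heq
    have hv := (hC u v huv).1 hu
    have hall : ∀ i ∈ (G.incidenceFinset v).image c, i = if x ⟨v, hv⟩ then 1 else 0 := by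
      intro i hi
      obtain ⟨e, he, rfl⟩ := mem_image.1 hi
      rw [SimpleGraph.mem_incidenceFinset] at he
      obtain ⟨w, rfl⟩ := Sym2.mem_iff_exists.1 he.2
      rw [Sym2.eq_swap]
      exact hcx w ⟨v, hv⟩ (G.adj_symm he.1)
    have hmem : ∀ t : Bool, (if t then 1 else 0 : Fin 2) ∈ (G.incidenceFinset u).image c := by
      intro t
      obtain ⟨b, hb, rfl⟩ := hx ⟨u, hu⟩ t
      rw [mem_image]
      exact ⟨s(u, b), by rw [SimpleGraph.mem_incidenceFinset]; exact ⟨hb, Sym2.mem_mk_left _ _⟩,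
        hcx u b hb⟩
    have h1 := hall _ (heq ▸ hmem true)
    have h0 := hall _ (heq ▸ hmem false)
    rw [← h0] at h1
    exact absurd h1 (by decide)
  refine ⟨c, fun u v huv => ?_⟩
  by_cases hu : C u = 0
  · exact key u v huv hu
  · exact (key v u huv.symm ((hC v u huv.symm).2 hu)).symm

end SignMatrix

/-- For every `k ≥ 4`, every `k`-regular bipartite graph `G` satisfies `gndi(G) = 2`:
`G` admits an edge labeling with two labels distinguishing neighbors by sets. -/
theorem regular_bipartite_gndi_two
    {V : Type} [Fintype V] [DecidableEq V]
    (G : SimpleGraph V) [DecidableRel G.Adj] (k : ℕ) (hk : 4 ≤ k)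
    (hreg : G.IsRegularOfDegree k) (hbip : G.Colorable 2) :
    ∃ c : Sym2 V → Fin 2, ∀ u v : V, G.Adj u v →
      (G.incidenceFinset u).image c ≠ (G.incidenceFinset v).image c := by
  exact SignMatrix.exists_two_labeling_of_regular_of_colorable_two G k hk hreg hbip
end

section
/- Let G be a connected bipartite graph with at least two vertices and minimum degree at least 2, and let c : E → {1,2} be an edge labeling. Then c is an edge-labeling by gap if and only if c distinguishes neighbors by sets. -/
/-- A set of labels in `{1, 2}` is the interval between its minimum and its maximum. -/
theorem Finset.eq_Icc_of_forall_eq_one_or_two {S : Finset ℕ} (hS : ∀ x ∈ S, x = 1 ∨ x = 2)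
    {m M : ℕ} (hm : m ∈ S) (hM : M ∈ S) (hmin : ∀ x ∈ S, m ≤ x) (hmax : ∀ x ∈ S, x ≤ M) :
    S = Finset.Icc m M := by
  ext x
  rw [Finset.mem_Icc]
  refine ⟨fun hx => ⟨hmin x hx, hmax x hx⟩, fun hx => ?_⟩
  have h1 := hS m hm
  have h2 := hS M hM
  obtain rfl | rfl : x = m ∨ x = M := by omega
  exacts [hm, hM]

/-- Intersecting sets of labels in `{1, 2}` have the same gap exactly when they are equal. -/
theorem Finset.gap_eq_iff_eq {S T : Finset ℕ} (hS : ∀ x ∈ S, x = 1 ∨ x = 2)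
    (hT : ∀ x ∈ T, x = 1 ∨ x = 2) {x : ℕ} (hxS : x ∈ S) (hxT : x ∈ T) {m M m' M' : ℕ}
    (hm : m ∈ S) (hM : M ∈ S) (hmin : ∀ x ∈ S, m ≤ x) (hmax : ∀ x ∈ S, x ≤ M)
    (hm' : m' ∈ T) (hM' : M' ∈ T) (hmin' : ∀ x ∈ T, m' ≤ x) (hmax' : ∀ x ∈ T, x ≤ M') :
    M - m = M' - m' ↔ S = T := by
  constructor
  · intro h
    rw [Finset.eq_Icc_of_forall_eq_one_or_two hS hm hM hmin hmax,
      Finset.eq_Icc_of_forall_eq_one_or_two hT hm' hM' hmin' hmax']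
    have h1 := hS m hm
    have h2 := hS M hM
    have h3 := hT m' hm'
    have h4 := hT M' hM'
    have h5 := hmin x hxS
    have h6 := hmax x hxS
    have h7 := hmin' x hxT
    have h8 := hmax' x hxT
    obtain rfl : m = m' := by omega
    obtain rfl : M = M' := by omega
    rfl
  · rintro rfl
    rw [le_antisymm (hmax' M hM) (hmax M' hM'), le_antisymm (hmin m' hm') (hmin' m hm)]

/-- Let `G` be a connected bipartite graph with at least two vertices and minimum degree at
least `2`, and let `c : E → {1,2}` be an edge labeling.  Then `c` is an edge-labeling by
gap (the vertex coloring `f`, where `f v` is the label of the unique incident edge if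
`deg v = 1` and `f v = max_{e ∋ v} c e − min_{e ∋ v} c e` otherwise, is proper) if and only
if `c` distinguishes neighbors by sets. -/
theorem gap_labeling_iff_distinguishing_by_sets
    {V : Type} [Fintype V] [DecidableEq V]
    (G : SimpleGraph V) [DecidableRel G.Adj]
    (hconn : G.Connected) (hbip : G.Colorable 2)
    (hcard : 2 ≤ Fintype.card V)
    (hδ : ∀ v : V, 2 ≤ G.degree v)
    (c : Sym2 V → ℕ)
    (hc : ∀ e ∈ G.edgeFinset, c e = 1 ∨ c e = 2) :
    (∃ f : V → ℕ,
      (∀ (v : V), ∀ e ∈ G.incidenceFinset v, G.degree v = 1 → f v = c e) ∧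
      (∀ v : V, G.degree v ≠ 1 →
        ∃ eM ∈ G.incidenceFinset v, ∃ em ∈ G.incidenceFinset v,
          f v = c eM - c em ∧
          (∀ e ∈ G.incidenceFinset v, c e ≤ c eM) ∧
          (∀ e ∈ G.incidenceFinset v, c em ≤ c e)) ∧
      (∀ u v : V, G.Adj u v → f u ≠ f v)) ↔
    (∀ u v : V, G.Adj u v →
      (G.incidenceFinset u).image c ≠ (G.incidenceFinset v).image c) := by
  have hlabel (v : V) : ∀ x ∈ (G.incidenceFinset v).image c, x = 1 ∨ x = 2 :=
    Finset.forall_mem_image.2 fun e he =>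
      hc e (SimpleGraph.mem_edgeFinset.2 ((G.mem_incidenceFinset v e).1 he).1)
  have hgap {u v : V} (huv : G.Adj u v) {eM em eM' em' : Sym2 V}
      (hM : eM ∈ G.incidenceFinset u) (hm : em ∈ G.incidenceFinset u)
      (hmax : ∀ e ∈ G.incidenceFinset u, c e ≤ c eM)
      (hmin : ∀ e ∈ G.incidenceFinset u, c em ≤ c e)
      (hM' : eM' ∈ G.incidenceFinset v) (hm' : em' ∈ G.incidenceFinset v)
      (hmax' : ∀ e ∈ G.incidenceFinset v, c e ≤ c eM')
      (hmin' : ∀ e ∈ G.incidenceFinset v, c em' ≤ c e) :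
      c eM - c em = c eM' - c em' ↔
        (G.incidenceFinset u).image c = (G.incidenceFinset v).image c := by
    have hu : s(u, v) ∈ G.incidenceFinset u := by
      simpa [SimpleGraph.mem_incidenceFinset, SimpleGraph.incidenceSet] using huv
    have hv : s(u, v) ∈ G.incidenceFinset v := by
      simpa [SimpleGraph.mem_incidenceFinset, SimpleGraph.incidenceSet] using huv
    exact Finset.gap_eq_iff_eq (hlabel u) (hlabel v)
      (Finset.mem_image_of_mem c hu) (Finset.mem_image_of_mem c hv)
      (Finset.mem_image_of_mem c hm) (Finset.mem_image_of_mem c hM)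
      (Finset.forall_mem_image.2 hmin) (Finset.forall_mem_image.2 hmax)
      (Finset.mem_image_of_mem c hm') (Finset.mem_image_of_mem c hM')
      (Finset.forall_mem_image.2 hmin') (Finset.forall_mem_image.2 hmax')
  have hdeg (v : V) : G.degree v ≠ 1 := by
    have := hδ v
    omega
  constructor
  · rintro ⟨f, -, hf, hproper⟩ u v huv heq
    obtain ⟨eM, hM, em, hm, hfu, hmax, hmin⟩ := hf u (hdeg u)
    obtain ⟨eM', hM', em', hm', hfv, hmax', hmin'⟩ := hf v (hdeg v)
    refine hproper u v huv ?_
    rw [hfu, hfv]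
    exact (hgap huv hM hm hmax hmin hM' hm' hmax' hmin').2 heq
  · intro h
    have hne (v : V) : (G.incidenceFinset v).Nonempty := by
      rw [← Finset.card_pos, G.card_incidenceFinset_eq_degree]
      exact two_pos.trans_le (hδ v)
    choose eM hM hmax using fun v => Finset.exists_max_image _ c (hne v)
    choose em hm hmin using fun v => Finset.exists_min_image _ c (hne v)
    refine ⟨fun v => c (eM v) - c (em v), fun v _ _ hv => absurd hv (hdeg v),
      fun v _ => ⟨eM v, hM v, em v, hm v, rfl, hmax v, hmin v⟩, fun u v huv heq => h u v huv ?_⟩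
    exact (hgap huv (hM u) (hm u) (hmax u) (hmin u) (hM v) (hm v) (hmax v) (hmin v)).1 heq
end

section
/- A graph G has a total labeling c : V ∪ E → {1,2} distinguishing neighbors by sets if and only if G is bipartite. (If G is bipartite, assigning label 1 to all edges and extending a proper 2-coloring of the vertices gives such a labeling; conversely, if such a labeling c exists, then the sets c^{-1}-induced classes {v : c(E(v) ∪ {v}) = {1,2}} and {v : c(E(v) ∪ {v}) ∈ {{1},{2}}} form a bipartition of G.) -/
/-- Two subsets of `{1, 2}` with a common element are equal as soon as both or neither of them
is the whole of `{1, 2}`. -/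
theorem Finset.eq_of_subset_one_two {A B : Finset ℕ} {x : ℕ} (hA : A ⊆ {1, 2}) (hB : B ⊆ {1, 2})
    (hxA : x ∈ A) (hxB : x ∈ B) (h : A = {1, 2} ↔ B = {1, 2}) : A = B := by
  have key : ∀ A ∈ ({1, 2} : Finset ℕ).powerset, ∀ B ∈ ({1, 2} : Finset ℕ).powerset,
      ∀ x ∈ A, x ∈ B → (A = {1, 2} ↔ B = {1, 2}) → A = B := by decide
  exact key A (Finset.mem_powerset.2 hA) B (Finset.mem_powerset.2 hB) x hxA hxB h

/-- A graph `G` has a total labeling with labels `{1,2}` distinguishing neighbors by sets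
if and only if `G` is bipartite. -/
theorem total_labeling_two_labels_iff_bipartite
    {V : Type} [Fintype V] [DecidableEq V]
    (G : SimpleGraph V) [DecidableRel G.Adj] :
    (∃ (cV : V → ℕ) (cE : Sym2 V → ℕ),
      (∀ v : V, cV v = 1 ∨ cV v = 2) ∧
      (∀ e ∈ G.edgeFinset, cE e = 1 ∨ cE e = 2) ∧
      ∀ u v : V, G.Adj u v →
        insert (cV u) ((G.incidenceFinset u).image cE) ≠
          insert (cV v) ((G.incidenceFinset v).image cE)) ↔
    G.Colorable 2 := by
  constructor
  · rintro ⟨cV, cE, hV, hE, h⟩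
    have hsub (v : V) : insert (cV v) ((G.incidenceFinset v).image cE) ⊆ {1, 2} := by
      intro x hx
      rw [Finset.mem_insert, Finset.mem_image] at hx
      obtain rfl | ⟨e, he, rfl⟩ := hx
      · simpa using hV v
      · simpa using hE e (G.incidenceFinset_subset v he)
    have hmem {u v : V} (huv : G.Adj u v) :
        cE s(u, v) ∈ insert (cV u) ((G.incidenceFinset u).image cE) :=
      Finset.mem_insert_of_mem <| Finset.mem_image_of_mem cE <| by
        simpa [SimpleGraph.mem_incidenceFinset] using huv
    refine (SimpleGraph.Coloring.mk (fun v : V =>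
      decide (insert (cV v) ((G.incidenceFinset v).image cE) = {1, 2})) ?_).colorable
    intro u v huv heq
    exact h u v huv (Finset.eq_of_subset_one_two (hsub u) (hsub v) (hmem huv)
      (Sym2.eq_swap (a := u) ▸ hmem huv.symm) (decide_eq_decide.1 heq))
  · rintro ⟨c⟩
    refine ⟨fun v => c v + 1, fun _ => 1, fun v => by have := (c v).isLt; dsimp only; lia,
      fun _ _ => Or.inl rfl, fun u v huv heq => c.valid huv ?_⟩
    have hiff := Finset.ext_iff.1 heq 2
    simp only [Finset.mem_insert, Finset.mem_image, OfNat.one_ne_ofNat, and_false,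
      exists_false, or_false] at hiff
    have := (c u).isLt
    have := (c v).isLt
    exact Fin.ext (by lia)
end
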